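/- arXiv:2101.10139 — 3 statements merged into one kernel-verified Lean document; each statement's English description precedes it below -/
import Mathlib

section
/- Let χ > 0 be such that a₂ := w₁ − k₂ m χ^{2(γ−1)} > 0, let L = m m₁ k₂ + m² k₃, H₁ = (k₀/(h k₂ m (1 + χ^{−2μ})))^{1/(μ−1)}, H₂ = (min{w₀/(4hL), w₁/(2hL), w₂/(2L)})^{1/(μ−1)}, and let δ ∈ (0, min{H₁, H₂}). Set a₁ = k₀ − h k₂ m (1 + χ^{−2μ}) δ^{μ−1}, β = (2 k₂ m + w₁ + h w₂)·h, and let Δ > 0 be a root of k₁Δ^γ + βΔ^{γ+μ−1} = a₁δ^γ. Then every solution x of the delay system with initial function φ satisfying ‖φ‖_h < Δ obeys ‖x(t)‖ < δ for all t ≥ 0 and x(t) → 0 as t → ∞. -/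
open Real Set RealInnerProductSpace

/-- Derivative at the base point of an integral with moving end and moving integrand. -/
lemma lk_base {F : Type*} [NormedAddCommGroup F] [NormedSpace ℝ F] [CompleteSpace F]
    {g : ℝ → ℝ → F} (hg : Continuous (Function.uncurry g)) (t₀ : ℝ) :
    HasDerivAt (fun t => ∫ s in t₀..t, g t s) (g t₀ t₀) t₀ := by
  rw [hasDerivAt_iff_isLittleO, Asymptotics.isLittleO_iff]
  intro c hc
  have h1 := Metric.continuousAt_iff.1 (hg.continuousAt (x := (t₀, t₀))) c hc
  obtain ⟨r, hr, h2⟩ := h1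
  filter_upwards [Metric.ball_mem_nhds t₀ hr] with t ht
  have hgt : ∀ u, Continuous (g u) := fun u => hg.comp (by fun_prop : Continuous fun s => (u, s))
  have e : (∫ s in t₀..t, g t s) - (∫ s in t₀..t₀, g t₀ s) - (t - t₀) • g t₀ t₀
      = ∫ s in t₀..t, (g t s - g t₀ t₀) := by
    rw [intervalIntegral.integral_sub ((hgt t).intervalIntegrable _ _)
      (continuous_const.intervalIntegrable _ _)]
    simp
  rw [e, Real.norm_eq_abs]
  apply intervalIntegral.norm_integral_le_of_norm_le_const
  intro s hs
  have hs' : dist s t₀ < r := by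
    have : |s - t₀| ≤ |t - t₀| := by
      rcases Set.mem_uIoc.1 hs with h | h
      · rw [abs_of_pos (by linarith), abs_of_pos (by linarith)]; linarith
      · rw [abs_of_nonpos (by linarith), abs_of_nonpos (by linarith)]; linarith
    rw [Real.dist_eq]
    rw [Metric.mem_ball, Real.dist_eq] at ht
    linarith
  have := @h2 (t, s) (by
    rw [Prod.dist_eq]; exact max_lt ht hs')
  rw [dist_eq_norm] at this
  exact this.le

/-- Leibniz rule on a sliding window. -/
lemma lk_leibniz {F : Type*} [NormedAddCommGroup F] [NormedSpace ℝ F] [CompleteSpace F]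
    {g g' : ℝ → ℝ → F} (hg : Continuous (Function.uncurry g))
    (hg' : Continuous (Function.uncurry g'))
    (hd : ∀ t > 0, ∀ s, HasDerivAt (fun t => g t s) (g' t s) t) (h : ℝ) (t₀ : ℝ) (ht₀ : 0 < t₀) :
    HasDerivAt (fun t => ∫ s in (t - h)..t, g t s)
      (g t₀ t₀ - g t₀ (t₀ - h) + ∫ s in (t₀ - h)..t₀, g' t₀ s) t₀ := by
  have hgt : ∀ u, Continuous (g u) := fun u => hg.comp (by fun_prop : Continuous fun s => (u, s))
  have hgt' : ∀ u, Continuous (g' u) :=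
    fun u => hg'.comp (by fun_prop : Continuous fun s => (u, s))
  have h1 := lk_base hg t₀
  have h2 : HasDerivAt (fun t => ∫ s in t₀..t, g t (s - h)) (g t₀ (t₀ - h)) t₀ :=
    lk_base (g := fun t s => g t (s - h))
      (hg.comp (by fun_prop : Continuous fun p : ℝ × ℝ => (p.1, p.2 - h))) t₀
  have h3 : HasDerivAt (fun t => ∫ s in (t₀ - h)..t₀, g t s) (∫ s in (t₀ - h)..t₀, g' t₀ s) t₀ := by
    obtain ⟨C, hC⟩ := ((isCompact_Icc (a := t₀ / 2) (b := 2 * t₀)).prod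
      (isCompact_uIcc (a := t₀ - h) (b := t₀))).exists_bound_of_continuousOn hg'.continuousOn
    refine (intervalIntegral.hasDerivAt_integral_of_dominated_loc_of_deriv_le
      (bound := fun _ => C) (s := Set.Icc (t₀ / 2) (2 * t₀)) (Icc_mem_nhds (by linarith) (by linarith))
      (Filter.Eventually.of_forall fun t => (hgt t).aestronglyMeasurable)
      ((hgt t₀).intervalIntegrable _ _) (hgt' t₀).aestronglyMeasurable
      (Filter.Eventually.of_forall fun s hs t ht => ?_) (continuous_const.intervalIntegrable _ _)
      (Filter.Eventually.of_forall fun s hs t ht => ?_)).2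
    · exact hC (t, s) ⟨ht, Set.uIoc_subset_uIcc hs⟩
    · exact hd t (by linarith [ht.1]) s
  have h4 := (h1.sub h2).add h3
  refine h4.congr_of_eventuallyEq (Filter.Eventually.of_forall fun t => ?_)
  have e1 : ∫ s in t₀..t, g t (s - h) = ∫ s in (t₀ - h)..(t - h), g t s :=
    intervalIntegral.integral_comp_sub_right (g t) h
  have i : ∀ a b, IntervalIntegrable (g t) MeasureTheory.volume a b :=
    fun a b => (hgt t).intervalIntegrable _ _
  have e2 := intervalIntegral.integral_add_adjacent_intervals (i (t₀ - h) t₀) (i t₀ t)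
  have e3 := intervalIntegral.integral_add_adjacent_intervals (i (t₀ - h) (t - h)) (i (t - h) t)
  simp only [Pi.add_apply, Pi.sub_apply]
  rw [e1]
  have : (∫ s in (t - h)..t, g t s) = (∫ s in (t₀ - h)..t, g t s) - ∫ s in (t₀ - h)..(t - h), g t s := by
    rw [← e3]; abel
  rw [this, ← e2]; abel

lemma lk_cont {F : Type*} [NormedAddCommGroup F] [NormedSpace ℝ F]
    {g : ℝ → ℝ → F} (hg : Continuous (Function.uncurry g)) (h : ℝ) :
    Continuous (fun t => ∫ s in (t - h)..t, g t s) := by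
  have : (fun t => ∫ s in (t - h)..t, g t s) = fun t => ∫ s in (-h)..0, g t (s + t) := by
    ext t
    rw [intervalIntegral.integral_comp_add_right (g t) t]
    congr 1 <;> ring
  rw [this]
  exact intervalIntegral.continuous_parametric_intervalIntegral_of_continuous'
    (f := fun t s => g t (s + t))
    (hg.comp (by fun_prop : Continuous fun p : ℝ × ℝ => (p.1, p.2 + p.1))) _ _

lemma lk_mul2 {a b α β : ℝ} (ha : 0 ≤ a) (hb : 0 ≤ b) (hα : 0 ≤ α) (hβ : 0 ≤ β) :
    a ^ α * b ^ β ≤ a ^ (α + β) + b ^ (α + β) := by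
  have h1 : (0:ℝ) ≤ a ^ (α + β) := by positivity
  have h2 : (0:ℝ) ≤ b ^ (α + β) := by positivity
  rcases le_total a b with h | h
  · have : a ^ α * b ^ β ≤ b ^ α * b ^ β := by gcongr
    rw [← Real.rpow_add_of_nonneg hb hα hβ] at this
    linarith
  · have : a ^ α * b ^ β ≤ a ^ α * a ^ β := by gcongr
    rw [← Real.rpow_add_of_nonneg ha hα hβ] at this
    linarith

lemma lk_mul3 {a b c α β κ : ℝ} (ha : 0 ≤ a) (hb : 0 ≤ b) (hc : 0 ≤ c)
    (hα : 0 ≤ α) (hβ : 0 ≤ β) (hκ : 0 ≤ κ) :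
    a ^ α * b ^ β * c ^ κ ≤ a ^ (α + β + κ) + b ^ (α + β + κ) + c ^ (α + β + κ) := by
  have key : ∀ M, 0 ≤ M → a ≤ M → b ≤ M → c ≤ M → a ^ α * b ^ β * c ^ κ ≤ M ^ (α + β + κ) := by
    intro M hM h1 h2 h3
    rw [Real.rpow_add_of_nonneg hM (by positivity) hκ, Real.rpow_add_of_nonneg hM hα hβ]
    gcongr
  have h1 : (0:ℝ) ≤ a ^ (α + β + κ) := by positivity
  have h2 : (0:ℝ) ≤ b ^ (α + β + κ) := by positivity
  have h3 : (0:ℝ) ≤ c ^ (α + β + κ) := by positivity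
  rcases le_total a b with h | h <;> rcases le_total b c with h' | h' <;>
    rcases le_total a c with h'' | h''
  all_goals first
    | linarith [key a ha le_rfl (by linarith) (by linarith)]
    | linarith [key b hb (by linarith) le_rfl (by linarith)]
    | linarith [key c hc (by linarith) (by linarith) le_rfl]

lemma lk_young {a c χ γ μ : ℝ} (ha : 0 ≤ a) (hc : 0 ≤ c) (hχ : 0 < χ) (hγ : 2 ≤ γ) (hμ : 1 < μ) :
    a ^ (γ - 1) * c ^ μ ≤
      χ ^ (-(2 * μ)) * a ^ (γ + μ - 1) + χ ^ (2 * (γ - 1)) * c ^ (γ + μ - 1) := by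
  have e : γ + μ - 1 = (γ - 1) + μ := by ring
  have h1 : (0:ℝ) ≤ χ ^ (-(2 * μ)) * a ^ (γ + μ - 1) := by positivity
  have h2 : (0:ℝ) ≤ χ ^ (2 * (γ - 1)) * c ^ (γ + μ - 1) := by positivity
  rcases le_total c (χ ^ (-2 : ℝ) * a) with h | h
  · have : a ^ (γ - 1) * c ^ μ ≤ a ^ (γ - 1) * (χ ^ (-2 : ℝ) * a) ^ μ := by gcongr
    rw [Real.mul_rpow (by positivity) ha, ← Real.rpow_mul hχ.le] at this
    have ea : a ^ (γ + μ - 1) = a ^ (γ - 1) * a ^ μ := by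
      rw [e, Real.rpow_add_of_nonneg ha (by linarith) (by linarith)]
    rw [ea, show -(2 * μ) = -2 * μ by ring]
    linarith
  · have h' : a ≤ χ ^ (2:ℝ) * c := by
      rw [Real.rpow_neg hχ.le, inv_mul_le_iff₀ (by positivity)] at h
      exact h
    have : a ^ (γ - 1) * c ^ μ ≤ (χ ^ (2 : ℝ) * c) ^ (γ - 1) * c ^ μ := by
      gcongr; linarith
    rw [Real.mul_rpow (by positivity) hc, ← Real.rpow_mul hχ.le] at this
    have ec : c ^ (γ + μ - 1) = c ^ (γ - 1) * c ^ μ := by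
      rw [e, Real.rpow_add_of_nonneg hc (by linarith) (by linarith)]
    rw [ec]
    linarith

lemma lk_pt {a b c δ γ μ : ℝ} (ha : 0 ≤ a) (hb : 0 ≤ b) (hc : 0 ≤ c) (haδ : a ≤ δ) (hcδ : c ≤ δ)
    (hγ : 2 ≤ γ) (hμ : 1 < μ) :
    a ^ (γ - 2) * (a ^ μ + b ^ μ) * (a ^ μ + c ^ μ) ≤
      δ ^ (μ - 1) * (4 * a ^ (γ + μ - 1) + 2 * b ^ (γ + μ - 1) + 2 * c ^ (γ + μ - 1)) := by
  have ea : a ^ μ ≤ a * δ ^ (μ - 1) := by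
    calc a ^ μ = a ^ (1 + (μ - 1)) := by ring_nf
      _ = a * a ^ (μ - 1) := by rw [Real.rpow_add_of_nonneg ha (by norm_num) (by linarith), Real.rpow_one]
      _ ≤ _ := by gcongr
  have ec : c ^ μ ≤ c * δ ^ (μ - 1) := by
    calc c ^ μ = c ^ (1 + (μ - 1)) := by ring_nf
      _ = c * c ^ (μ - 1) := by rw [Real.rpow_add_of_nonneg hc (by norm_num) (by linarith), Real.rpow_one]
      _ ≤ _ := by gcongr
  have ee : γ - 2 + μ + 1 = γ + μ - 1 := by ring
  have m4 := lk_mul3 (α := γ - 2) (β := μ) (κ := 1) ha hb hc (by linarith) (by linarith) (by norm_num)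
  have m1' : a ^ (γ - 2) * a ^ μ * a = a ^ (γ + μ - 1) := by
    rw [← ee, Real.rpow_add_of_nonneg ha (by linarith) (by linarith),
      Real.rpow_add_of_nonneg ha (by linarith) (by linarith), Real.rpow_one]
  have m2' : a ^ (γ - 2) * b ^ μ * a ≤ a ^ (γ + μ - 1) + b ^ (γ + μ - 1) := by
    have := lk_mul2 (α := γ - 1) (β := μ) ha hb (by linarith) (by linarith)
    rw [show γ - 1 + μ = γ + μ - 1 by ring, show γ - 1 = γ - 2 + 1 by ring,
      Real.rpow_add_of_nonneg ha (by linarith) (by linarith), Real.rpow_one] at this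
    linarith
  have m3' : a ^ (γ - 2) * a ^ μ * c ≤ a ^ (γ + μ - 1) + c ^ (γ + μ - 1) := by
    have := lk_mul2 (α := γ - 2 + μ) (β := 1) ha hc (by linarith) (by linarith)
    rw [ee, Real.rpow_add_of_nonneg ha (by linarith) (by linarith), Real.rpow_one] at this
    linarith
  rw [ee, Real.rpow_one] at m4
  have hd : 0 ≤ δ ^ (μ - 1) := Real.rpow_nonneg (ha.trans haδ) _
  calc a ^ (γ - 2) * (a ^ μ + b ^ μ) * (a ^ μ + c ^ μ)
      ≤ a ^ (γ - 2) * (a ^ μ + b ^ μ) * (a * δ ^ (μ - 1) + c * δ ^ (μ - 1)) := by gcongr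
    _ = δ ^ (μ - 1) * (a ^ (γ - 2) * a ^ μ * a + a ^ (γ - 2) * b ^ μ * a
        + a ^ (γ - 2) * a ^ μ * c + a ^ (γ - 2) * b ^ μ * c) := by ring
    _ ≤ _ := mul_le_mul_of_nonneg_left (by linarith) hd

/-- The Lyapunov-Krasovskii functional along a trajectory. -/
noncomputable def lkV {E : Type*} [NormedAddCommGroup E] [InnerProductSpace ℝ E]
    (h w₁ w₂ p : ℝ) (V : E → ℝ) (G : E → E) (f : E × E → E) (y : ℝ → E) (t : ℝ) : ℝ :=
  V (y t) + inner ℝ (G (y t)) (∫ s in (t - h)..t, f (y t, y s))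
    + ∫ s in (t - h)..t, (w₁ + (h + s - t) * w₂) * ‖y s‖ ^ p

lemma lkV_cont {E : Type*} [NormedAddCommGroup E] [InnerProductSpace ℝ E]
    {h w₁ w₂ p : ℝ} (hp : 0 < p) {V : E → ℝ} {G : E → E} {f : E × E → E} {y : ℝ → E}
    (hV : Continuous V) (hG : Continuous G) (hf : Continuous f) (hy : Continuous y) :
    Continuous (lkV h w₁ w₂ p V G f y) := by
  have hq : Continuous fun s => ‖y s‖ ^ p :=
    hy.norm.rpow_const (fun _ => Or.inr hp.le)
  unfold lkV
  refine ((hV.comp hy).add ((hG.comp hy).inner ?_)).add ?_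
  · exact lk_cont (g := fun t s => f (y t, y s)) (by unfold Function.uncurry; fun_prop) h
  · exact lk_cont (g := fun t s => (w₁ + (h + s - t) * w₂) * ‖y s‖ ^ p)
      (((by fun_prop : Continuous fun q : ℝ × ℝ => (w₁ + (h + q.2 - q.1) * w₂))).mul
        (hq.comp continuous_snd)) h

lemma lkV_deriv {E : Type*} [NormedAddCommGroup E] [InnerProductSpace ℝ E] [CompleteSpace E]
    {h μ m m₁ γ k₂ k₃ w w₁ w₂ L δ : ℝ} (hh : 0 < h) (hμ : 1 < μ) (hm : 0 < m) (hm₁ : 0 < m₁)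
    (hγ : 2 ≤ γ) (hk₂ : 0 < k₂) (hk₃ : 0 < k₃)
    {f : E × E → E} (hf : ContDiff ℝ 1 f)
    (hfb : ∀ x y : E, ‖f (x, y)‖ ≤ m * (‖x‖ ^ μ + ‖y‖ ^ μ))
    (hfx : ∀ x y : E,
      ‖fderiv ℝ (fun x' => f (x', y)) x‖ ≤ m₁ * (‖x‖ ^ (μ - 1) + ‖y‖ ^ (μ - 1)))
    {V : E → ℝ} (hV : ContDiff ℝ 2 V)
    (hgrad : ∀ x : E, ‖gradient V x‖ ≤ k₂ * ‖x‖ ^ (γ - 1))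
    (hhess : ∀ x : E, ‖fderiv ℝ (gradient V) x‖ ≤ k₃ * ‖x‖ ^ (γ - 2))
    (hdV : ∀ x : E, inner ℝ (gradient V x) (f (x, x)) ≤ -w * ‖x‖ ^ (γ + μ - 1))
    (hL : L = m * m₁ * k₂ + m ^ 2 * k₃)
    (hδ1 : 2 * h * L * δ ^ (μ - 1) ≤ w₁) (hδ2 : 2 * L * δ ^ (μ - 1) ≤ w₂)
    {y : ℝ → E} (hy : Continuous y) (hyd : ∀ t > 0, HasDerivAt y (f (y t, y (t - h))) t)
    {t : ℝ} (ht : 0 < t) (hyδ : ∀ s ∈ Set.Icc (t - h) t, ‖y s‖ ≤ δ) :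
    ∃ D, HasDerivAt (lkV h w₁ w₂ (γ + μ - 1) V (gradient V) f y) D t ∧
      D ≤ -(w - w₁ - h * w₂ - 4 * h * L * δ ^ (μ - 1)) * ‖y t‖ ^ (γ + μ - 1) := by
  set p := γ + μ - 1 with hp
  have hp0 : 0 < p := by linarith
  have hVd : ∀ z, HasFDerivAt V (fderiv ℝ V z) z := fun z =>
    (hV.differentiable (by norm_num) z).hasFDerivAt
  have hGc : ContDiff ℝ 1 (gradient V) := by
    have h1 : ContDiff ℝ 1 (fderiv ℝ V) := hV.fderiv_right (by norm_num)
    exact (InnerProductSpace.toDual ℝ E).symm.contDiff.comp h1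
  have hGd : ∀ z, HasFDerivAt (gradient V) (fderiv ℝ (gradient V) z) z := fun z =>
    (hGc.differentiable (by norm_num) z).hasFDerivAt
  have hfd : ∀ z u, HasFDerivAt (fun x' => f (x', u))
      ((fderiv ℝ f (z, u)).comp (ContinuousLinearMap.inl ℝ E E)) z := fun z u => by
    have := (hf.differentiable (by norm_num) (z, u)).hasFDerivAt
    exact this.comp z (hasFDerivAt_prodMk_left z u)
  have hq : Continuous fun s => ‖y s‖ ^ p := hy.norm.rpow_const (fun _ => Or.inr hp0.le)
  have hfdc : Continuous (fderiv ℝ f) := hf.continuous_fderiv (by norm_num)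
  have hfc := hf.continuous
  -- the three pieces
  have d1 : HasDerivAt (fun t => V (y t)) (inner ℝ (gradient V (y t)) (f (y t, y (t - h)))) t := by
    have := (hVd (y t)).comp_hasDerivAt t (hyd t ht)
    have e : fderiv ℝ V (y t) (f (y t, y (t - h))) =
        inner ℝ (gradient V (y t)) (f (y t, y (t - h))) := by
      simp [gradient]
    rw [e] at this
    exact this
  set J : ℝ → ℝ → E := fun t s =>
    ((fderiv ℝ f (y t, y s)).comp (ContinuousLinearMap.inl ℝ E E)) (f (y t, y (t - h))) with hJ
  have d2 : HasDerivAt (fun t => ∫ s in (t - h)..t, f (y t, y s))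
      (f (y t, y t) - f (y t, y (t - h)) + ∫ s in (t - h)..t, J t s) t := by
    refine lk_leibniz (g := fun t s => f (y t, y s)) (g' := J) (by unfold Function.uncurry; fun_prop)
      ?_ ?_ h t ht
    · simp only [hJ]; unfold Function.uncurry; fun_prop
    · intro u hu s
      exact (hfd (y u) (y s)).comp_hasDerivAt u (hyd u hu)
  have d3 : HasDerivAt (fun t => ∫ s in (t - h)..t, (w₁ + (h + s - t) * w₂) * ‖y s‖ ^ p)
      ((w₁ + (h + t - t) * w₂) * ‖y t‖ ^ p - (w₁ + (h + (t - h) - t) * w₂) * ‖y (t - h)‖ ^ p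
        + ∫ s in (t - h)..t, (- w₂) * ‖y s‖ ^ p) t := by
    refine lk_leibniz (g := fun t s => (w₁ + (h + s - t) * w₂) * ‖y s‖ ^ p)
      (g' := fun t s => (- w₂) * ‖y s‖ ^ p) ?_ ?_ ?_ h t ht
    · exact (((by fun_prop : Continuous fun q : ℝ × ℝ => (w₁ + (h + q.2 - q.1) * w₂))).mul
        (hq.comp continuous_snd))
    · exact continuous_const.mul (hq.comp continuous_snd)
    · intro u _ s
      have := ((((hasDerivAt_id u).const_sub (h + s)).mul_const w₂).const_add w₁).mul_const (‖y s‖ ^ p)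
      simpa using this
  have dG : HasDerivAt (fun t => gradient V (y t))
      (fderiv ℝ (gradient V) (y t) (f (y t, y (t - h)))) t :=
    (hGd (y t)).comp_hasDerivAt t (hyd t ht)
  refine ⟨_, (d1.add (dG.inner ℝ d2)).add d3, ?_⟩
  -- estimates
  rw [intervalIntegral.integral_const_mul]
  set a := ‖y t‖ with ha
  set b := ‖y (t - h)‖ with hb
  set Q := ∫ s in (t - h)..t, ‖y s‖ ^ p with hQ
  have ha0 : 0 ≤ a := norm_nonneg _
  have hb0 : 0 ≤ b := norm_nonneg _
  have haδ : a ≤ δ := hyδ t ⟨by linarith, le_rfl⟩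
  have hδ0 : 0 ≤ δ := ha0.trans haδ
  have hth : t - h ≤ t := by linarith
  have hQ0 : 0 ≤ Q := intervalIntegral.integral_nonneg hth (fun s _ => by positivity)
  set dd := δ ^ (μ - 1) with hdd
  have hdd0 : 0 ≤ dd := by positivity
  have R1 : inner ℝ (gradient V (y t)) (∫ s in (t - h)..t, J t s) ≤
      m * m₁ * k₂ * dd * (h * (4 * a ^ p + 2 * b ^ p)) := by
    have hJb : ‖∫ s in (t - h)..t, J t s‖ ≤ (m₁ * (2 * dd)) * (m * (a ^ μ + b ^ μ)) * |t - (t - h)| := by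
      apply intervalIntegral.norm_integral_le_of_norm_le_const
      intro s hs
      rw [Set.uIoc_of_le hth] at hs
      have hcδ := hyδ s ⟨hs.1.le, hs.2⟩
      have h1 := hfx (y t) (y s)
      rw [(hfd (y t) (y s)).fderiv] at h1
      have h2 : ‖y t‖ ^ (μ - 1) ≤ dd := Real.rpow_le_rpow ha0 haδ (by linarith)
      have h3 : ‖y s‖ ^ (μ - 1) ≤ dd := Real.rpow_le_rpow (norm_nonneg _) hcδ (by linarith)
      calc ‖J t s‖ ≤ _ := ContinuousLinearMap.le_opNorm _ _
        _ ≤ (m₁ * (2 * dd)) * (m * (a ^ μ + b ^ μ)) := by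
          gcongr
          · refine h1.trans ?_
            gcongr
            linarith
          · exact hfb _ _
    rw [show t - (t - h) = h by ring, abs_of_pos hh] at hJb
    have e1 : a ^ (γ - 1) * a ^ μ = a ^ p := by
      rw [← Real.rpow_add_of_nonneg ha0 (by linarith) (by linarith)]; congr 1; rw [hp]; ring
    have e2 : a ^ (γ - 1) * b ^ μ ≤ a ^ p + b ^ p := by
      have := lk_mul2 (α := γ - 1) (β := μ) ha0 hb0 (by linarith) (by linarith)
      rwa [show γ - 1 + μ = p by rw [hp]; ring] at this
    calc _ ≤ ‖gradient V (y t)‖ * ‖∫ s in (t - h)..t, J t s‖ := real_inner_le_norm _ _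
      _ ≤ (k₂ * a ^ (γ - 1)) * ((m₁ * (2 * dd)) * (m * (a ^ μ + b ^ μ)) * h) := by
        gcongr
        exact hgrad _
      _ = m * m₁ * k₂ * dd * (h * (2 * (a ^ (γ - 1) * a ^ μ + a ^ (γ - 1) * b ^ μ))) := by ring
      _ ≤ _ := by
        gcongr
        linarith
  have R2 : inner ℝ (fderiv ℝ (gradient V) (y t) (f (y t, y (t - h))))
      (∫ s in (t - h)..t, f (y t, y s)) ≤
      m ^ 2 * k₃ * dd * (h * (4 * a ^ p + 2 * b ^ p) + 2 * Q) := by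
    have hμc : Continuous fun s => m * (a ^ μ + ‖y s‖ ^ μ) :=
      continuous_const.mul (continuous_const.add (hy.norm.rpow_const (fun _ => Or.inr (by linarith))))
    have hIb : ‖∫ s in (t - h)..t, f (y t, y s)‖ ≤ ∫ s in (t - h)..t, m * (a ^ μ + ‖y s‖ ^ μ) := by
      apply intervalIntegral.norm_integral_le_of_norm_le hth
      · exact Filter.Eventually.of_forall fun s _ => hfb _ _
      · exact hμc.intervalIntegrable _ _
    calc _ ≤ ‖fderiv ℝ (gradient V) (y t) (f (y t, y (t - h)))‖ * ‖∫ s in (t - h)..t, f (y t, y s)‖ :=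
          real_inner_le_norm _ _
      _ ≤ ((k₃ * a ^ (γ - 2)) * (m * (a ^ μ + b ^ μ))) *
          ∫ s in (t - h)..t, m * (a ^ μ + ‖y s‖ ^ μ) := by
        gcongr
        refine (ContinuousLinearMap.le_opNorm _ _).trans ?_
        gcongr
        · exact hhess _
        · exact hfb _ _
      _ = ∫ s in (t - h)..t, ((k₃ * a ^ (γ - 2)) * (m * (a ^ μ + b ^ μ))) *
          (m * (a ^ μ + ‖y s‖ ^ μ)) := by
        rw [← intervalIntegral.integral_const_mul]
      _ ≤ ∫ s in (t - h)..t, m ^ 2 * k₃ * dd * ((4 * a ^ p + 2 * b ^ p) + 2 * ‖y s‖ ^ p) := by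
        apply intervalIntegral.integral_mono_on hth
        · exact (continuous_const.mul hμc).intervalIntegrable _ _
        · exact (continuous_const.mul (continuous_const.add (continuous_const.mul hq))).intervalIntegrable _ _
        · intro s hs
          have := lk_pt ha0 hb0 (norm_nonneg (y s)) haδ (hyδ s hs) hγ hμ
          calc _ = m ^ 2 * k₃ * (a ^ (γ - 2) * (a ^ μ + b ^ μ) * (a ^ μ + ‖y s‖ ^ μ)) := by ring
            _ ≤ m ^ 2 * k₃ * (dd * (4 * a ^ p + 2 * b ^ p + 2 * ‖y s‖ ^ p)) :=
              mul_le_mul_of_nonneg_left this (by positivity)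
            _ = _ := by ring
      _ = _ := by
        have hq2 : IntervalIntegrable (fun s => 2 * ‖y s‖ ^ p) MeasureTheory.volume (t - h) t :=
          (continuous_const.mul hq).intervalIntegrable _ _
        rw [intervalIntegral.integral_const_mul, intervalIntegral.integral_add
          (continuous_const.intervalIntegrable _ _) hq2, intervalIntegral.integral_const_mul]
        rw [intervalIntegral.integral_const, smul_eq_mul, ← hQ]; ring
  have R3 := hdV (y t)
  rw [← ha] at R3
  rw [inner_add_right, inner_sub_right]
  have hbp : 0 ≤ b ^ p := by positivity
  have s1 := mul_le_mul_of_nonneg_right hδ1 hbp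
  have s2 := mul_le_mul_of_nonneg_right hδ2 hQ0
  have s3 : 0 ≤ m * m₁ * k₂ * dd * Q := by positivity
  subst hL
  linarith

lemma lkV_lower {E : Type*} [NormedAddCommGroup E] [InnerProductSpace ℝ E]
    {h μ m γ k₀ k₂ w₁ w₂ χ δ : ℝ} (hh : 0 < h) (hμ : 1 < μ) (hm : 0 < m)
    (hγ : 2 ≤ γ) (hk₂ : 0 < k₂) (hw₂ : 0 < w₂) (hχ : 0 < χ)
    (ha₂ : 0 < w₁ - k₂ * m * χ ^ (2 * (γ - 1)))
    {f : E × E → E} (hf : Continuous f)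
    (hfb : ∀ x y : E, ‖f (x, y)‖ ≤ m * (‖x‖ ^ μ + ‖y‖ ^ μ))
    {V : E → ℝ} {G : E → E} (hVlb : ∀ x : E, k₀ * ‖x‖ ^ γ ≤ V x)
    (hgrad : ∀ x : E, ‖G x‖ ≤ k₂ * ‖x‖ ^ (γ - 1))
    {y : ℝ → E} (hy : Continuous y) {t : ℝ} (hyδ : ‖y t‖ ≤ δ) :
    (k₀ - h * k₂ * m * (1 + χ ^ (-(2 * μ))) * δ ^ (μ - 1)) * ‖y t‖ ^ γ ≤
      lkV h w₁ w₂ (γ + μ - 1) V G f y t := by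
  set p := γ + μ - 1 with hp
  have hp0 : 0 < p := by linarith
  have hq : Continuous fun s => ‖y s‖ ^ p := hy.norm.rpow_const (fun _ => Or.inr hp0.le)
  have hth : t - h ≤ t := by linarith
  set a := ‖y t‖ with ha
  have ha0 : 0 ≤ a := norm_nonneg _
  have hδ0 : 0 ≤ δ := ha0.trans hyδ
  set Q := ∫ s in (t - h)..t, ‖y s‖ ^ p with hQ
  have hμc : Continuous fun s => m * (a ^ μ + ‖y s‖ ^ μ) :=
    continuous_const.mul (continuous_const.add (hy.norm.rpow_const (fun _ => Or.inr (by linarith))))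
  have hIb : ‖∫ s in (t - h)..t, f (y t, y s)‖ ≤ ∫ s in (t - h)..t, m * (a ^ μ + ‖y s‖ ^ μ) := by
    apply intervalIntegral.norm_integral_le_of_norm_le hth
    · exact Filter.Eventually.of_forall fun s _ => hfb _ _
    · exact hμc.intervalIntegrable _ _
  have e1 : a ^ (γ - 1) * a ^ μ = a ^ p := by
    rw [← Real.rpow_add_of_nonneg ha0 (by linarith) (by linarith)]; congr 1; rw [hp]; ring
  have B1 : -(inner ℝ (G (y t)) (∫ s in (t - h)..t, f (y t, y s))) ≤
      h * (k₂ * m * (1 + χ ^ (-(2 * μ))) * a ^ p) + k₂ * m * χ ^ (2 * (γ - 1)) * Q := by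
    calc _ ≤ ‖G (y t)‖ * ‖∫ s in (t - h)..t, f (y t, y s)‖ :=
          (neg_le_abs _).trans (abs_real_inner_le_norm _ _)
      _ ≤ (k₂ * a ^ (γ - 1)) * ∫ s in (t - h)..t, m * (a ^ μ + ‖y s‖ ^ μ) := by
        gcongr
        exact hgrad _
      _ = ∫ s in (t - h)..t, (k₂ * a ^ (γ - 1)) * (m * (a ^ μ + ‖y s‖ ^ μ)) := by
        rw [← intervalIntegral.integral_const_mul]
      _ ≤ ∫ s in (t - h)..t, (k₂ * m * (1 + χ ^ (-(2 * μ))) * a ^ p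
            + k₂ * m * χ ^ (2 * (γ - 1)) * ‖y s‖ ^ p) := by
        apply intervalIntegral.integral_mono_on hth
        · exact (continuous_const.mul hμc).intervalIntegrable _ _
        · exact (continuous_const.add (continuous_const.mul hq)).intervalIntegrable _ _
        · intro s hs
          have := lk_young ha0 (norm_nonneg (y s)) hχ hγ hμ
          calc _ = k₂ * m * (a ^ (γ - 1) * a ^ μ + a ^ (γ - 1) * ‖y s‖ ^ μ) := by ring
            _ ≤ k₂ * m * (a ^ p + (χ ^ (-(2 * μ)) * a ^ p + χ ^ (2 * (γ - 1)) * ‖y s‖ ^ p)) := by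
              rw [e1]
              exact mul_le_mul_of_nonneg_left (by linarith) (by positivity)
            _ = _ := by ring
      _ = _ := by
        have hq2 : IntervalIntegrable (fun s => k₂ * m * χ ^ (2 * (γ - 1)) * ‖y s‖ ^ p)
            MeasureTheory.volume (t - h) t := (continuous_const.mul hq).intervalIntegrable _ _
        rw [intervalIntegral.integral_add
          (continuous_const.intervalIntegrable _ _) hq2, intervalIntegral.integral_const]
        rw [intervalIntegral.integral_const_mul, smul_eq_mul, ← hQ]; ring
  have B2 : w₁ * Q ≤ ∫ s in (t - h)..t, (w₁ + (h + s - t) * w₂) * ‖y s‖ ^ p := by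
    rw [hQ, ← intervalIntegral.integral_const_mul]
    apply intervalIntegral.integral_mono_on hth
    · exact (continuous_const.mul hq).intervalIntegrable _ _
    · exact ((by fun_prop : Continuous fun s : ℝ => (w₁ + (h + s - t) * w₂)).mul
        hq).intervalIntegrable _ _
    · intro s hs
      have : 0 ≤ (h + s - t) * w₂ := mul_nonneg (by linarith [hs.1]) hw₂.le
      gcongr
      linarith
  have hQ0 : 0 ≤ Q := intervalIntegral.integral_nonneg hth (fun s _ => by positivity)
  have B3 : a ^ p ≤ δ ^ (μ - 1) * a ^ γ := by
    rw [show p = (μ - 1) + γ by rw [hp]; ring, Real.rpow_add_of_nonneg ha0 (by linarith) (by linarith)]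
    gcongr
  have B4 := mul_nonneg ha₂.le hQ0
  have B5 : h * (k₂ * m * (1 + χ ^ (-(2 * μ))) * a ^ p) ≤
      h * (k₂ * m * (1 + χ ^ (-(2 * μ))) * (δ ^ (μ - 1) * a ^ γ)) := by gcongr
  have B6 := hVlb (y t)
  unfold lkV
  rw [← ha] at B6
  linarith

lemma lkV_upper {E : Type*} [NormedAddCommGroup E] [InnerProductSpace ℝ E]
    {h μ m γ k₁ k₂ w₁ w₂ r : ℝ} (hh : 0 < h) (hμ : 1 < μ) (hm : 0 < m)
    (hγ : 2 ≤ γ) (hk₁ : 0 < k₁) (hk₂ : 0 < k₂) (hw₁ : 0 < w₁) (hw₂ : 0 < w₂)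
    {f : E × E → E}
    (hfb : ∀ x y : E, ‖f (x, y)‖ ≤ m * (‖x‖ ^ μ + ‖y‖ ^ μ))
    {V : E → ℝ} {G : E → E} (hVub : ∀ x : E, V x ≤ k₁ * ‖x‖ ^ γ)
    (hgrad : ∀ x : E, ‖G x‖ ≤ k₂ * ‖x‖ ^ (γ - 1))
    {y : ℝ → E} {t : ℝ} (hyr : ∀ s ∈ Set.Icc (t - h) t, ‖y s‖ ≤ r) :
    lkV h w₁ w₂ (γ + μ - 1) V G f y t ≤
      k₁ * r ^ γ + ((2 * k₂ * m + w₁ + h * w₂) * h) * r ^ (γ + μ - 1) := by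
  set p := γ + μ - 1 with hp
  have hp0 : 0 < p := by linarith
  have hth : t - h ≤ t := by linarith
  have hr : ‖y t‖ ≤ r := hyr t ⟨hth, le_rfl⟩
  have hr0 : 0 ≤ r := (norm_nonneg _).trans hr
  have e1 : r ^ (γ - 1) * r ^ μ = r ^ p := by
    rw [← Real.rpow_add_of_nonneg hr0 (by linarith) (by linarith)]; congr 1; rw [hp]; ring
  have hab : |t - (t - h)| = h := by rw [show t - (t - h) = h by ring, abs_of_pos hh]
  have A1 : V (y t) ≤ k₁ * r ^ γ := (hVub _).trans (by gcongr)
  have A2 : inner ℝ (G (y t)) (∫ s in (t - h)..t, f (y t, y s)) ≤ 2 * k₂ * m * h * r ^ p := by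
    have hI : ‖∫ s in (t - h)..t, f (y t, y s)‖ ≤ (m * (r ^ μ + r ^ μ)) * |t - (t - h)| := by
      apply intervalIntegral.norm_integral_le_of_norm_le_const
      intro s hs
      rw [Set.uIoc_of_le hth] at hs
      have := hyr s ⟨hs.1.le, hs.2⟩
      refine (hfb _ _).trans ?_
      gcongr
    rw [hab] at hI
    calc _ ≤ ‖G (y t)‖ * ‖∫ s in (t - h)..t, f (y t, y s)‖ := real_inner_le_norm _ _
      _ ≤ (k₂ * r ^ (γ - 1)) * ((m * (r ^ μ + r ^ μ)) * h) := by
        gcongr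
        refine (hgrad _).trans ?_
        gcongr
        linarith
      _ = 2 * k₂ * m * h * (r ^ (γ - 1) * r ^ μ) := by ring
      _ = _ := by rw [e1]
  have A3 : ∫ s in (t - h)..t, (w₁ + (h + s - t) * w₂) * ‖y s‖ ^ p ≤ (w₁ + h * w₂) * r ^ p * h := by
    suffices hs : ‖∫ s in (t - h)..t, (w₁ + (h + s - t) * w₂) * ‖y s‖ ^ p‖ ≤
        (w₁ + h * w₂) * r ^ p * |t - (t - h)| by
      rw [hab] at hs
      exact (le_abs_self _).trans hs
    apply intervalIntegral.norm_integral_le_of_norm_le_const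
    intro s hs
    rw [Set.uIoc_of_le hth] at hs
    have := hyr s ⟨hs.1.le, hs.2⟩
    have h1 : 0 ≤ h + s - t := by linarith [hs.1]
    have h2 : h + s - t ≤ h := by linarith [hs.2]
    rw [Real.norm_eq_abs, abs_of_nonneg (by positivity)]
    gcongr
  unfold lkV
  linarith

lemma lk_root {δ M μ : ℝ} (hδ : 0 < δ) (hM : 0 ≤ M) (hμ : 1 < μ) (h : δ < M ^ (1 / (μ - 1))) :
    δ ^ (μ - 1) < M := by
  have h1 := Real.rpow_lt_rpow hδ.le h (sub_pos.2 hμ)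
  rwa [← Real.rpow_mul hM, one_div_mul_cancel (sub_pos.2 hμ).ne', Real.rpow_one] at h1

/-- Krasovskii-based estimate of the domain of attraction (Theorem 4): if `Δ > 0` is a root of
`k₁Δ^γ + βΔ^{γ+μ-1} = a₁δ^γ`, then solutions with `‖φ‖_h < Δ` stay in the ball of radius `δ`
and tend to zero. -/
theorem attraction_region_LK
    {n : ℕ} (hn : 1 ≤ n)
    (h μ : ℝ) (hh : 0 < h) (hμ : 1 < μ)
    (f : EuclideanSpace ℝ (Fin n) × EuclideanSpace ℝ (Fin n) → EuclideanSpace ℝ (Fin n))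
    (hf : ContDiff ℝ 1 f)
    (hhom : ∀ c > (0:ℝ), ∀ x y : EuclideanSpace ℝ (Fin n),
      f (c • x, c • y) = (c ^ μ) • f (x, y))
    (m m₁ : ℝ) (hm : 0 < m) (hm₁ : 0 < m₁)
    (hfb : ∀ x y : EuclideanSpace ℝ (Fin n), ‖f (x, y)‖ ≤ m * (‖x‖ ^ μ + ‖y‖ ^ μ))
    (hfx : ∀ x y : EuclideanSpace ℝ (Fin n),
      ‖fderiv ℝ (fun x' => f (x', y)) x‖ ≤ m₁ * (‖x‖ ^ (μ - 1) + ‖y‖ ^ (μ - 1)))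
    (γ : ℝ) (hγ : 2 ≤ γ)
    (V : EuclideanSpace ℝ (Fin n) → ℝ) (hV : ContDiff ℝ 2 V)
    (k₀ k₁ k₂ k₃ w : ℝ) (hk₀ : 0 < k₀) (hk₁ : 0 < k₁) (hk₂ : 0 < k₂) (hk₃ : 0 < k₃)
    (hw : 0 < w)
    (hVlb : ∀ x : EuclideanSpace ℝ (Fin n), k₀ * ‖x‖ ^ γ ≤ V x)
    (hVub : ∀ x : EuclideanSpace ℝ (Fin n), V x ≤ k₁ * ‖x‖ ^ γ)
    (hgrad : ∀ x : EuclideanSpace ℝ (Fin n), ‖gradient V x‖ ≤ k₂ * ‖x‖ ^ (γ - 1))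
    (hhess : ∀ x : EuclideanSpace ℝ (Fin n),
      ‖fderiv ℝ (gradient V) x‖ ≤ k₃ * ‖x‖ ^ (γ - 2))
    (hdV : ∀ x : EuclideanSpace ℝ (Fin n),
      ⟪gradient V x, f (x, x)⟫ ≤ -w * ‖x‖ ^ (γ + μ - 1))
    (w₀ w₁ w₂ : ℝ) (hw₁ : 0 < w₁) (hw₂ : 0 < w₂)
    (hw₀ : w₀ = w - w₁ - h * w₂) (hw₀pos : 0 < w₀)
    (χ a₂ L H₁ H₂ δ a₁ β Δ : ℝ)
    (hχ : 0 < χ)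
    (ha₂ : a₂ = w₁ - k₂ * m * χ ^ (2 * (γ - 1))) (ha₂pos : 0 < a₂)
    (hL : L = m * m₁ * k₂ + m ^ 2 * k₃)
    (hH₁ : H₁ = (k₀ / (h * k₂ * m * (1 + χ ^ (-(2 * μ))))) ^ (1 / (μ - 1)))
    (hH₂ : H₂ = (min (w₀ / (4 * h * L)) (min (w₁ / (2 * h * L)) (w₂ / (2 * L)))) ^
      (1 / (μ - 1)))
    (hδ : δ ∈ Set.Ioo 0 (min H₁ H₂))
    (ha₁ : a₁ = k₀ - h * k₂ * m * (1 + χ ^ (-(2 * μ))) * δ ^ (μ - 1))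
    (hβ : β = (2 * k₂ * m + w₁ + h * w₂) * h)
    (hΔpos : 0 < Δ) (hΔ : k₁ * Δ ^ γ + β * Δ ^ (γ + μ - 1) = a₁ * δ ^ γ)
    (φ x : ℝ → EuclideanSpace ℝ (Fin n))
    (hφc : ContinuousOn φ (Set.Icc (-h) 0))
    (hxc : ContinuousOn x (Set.Ici (-h)))
    (hxφ : ∀ θ ∈ Set.Icc (-h) (0:ℝ), x θ = φ θ)
    (hxd : ∀ t > (0:ℝ), HasDerivAt x (f (x t, x (t - h))) t)
    (hφΔ : (⨆ θ : Set.Icc (-h) (0:ℝ), ‖φ θ.1‖) < Δ) :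
    (∀ t ≥ (0:ℝ), ‖x t‖ < δ) ∧ Filter.Tendsto x Filter.atTop (nhds 0) := by
  have hp0 : 0 < γ + μ - 1 := by linarith
  have hLpos : 0 < L := by rw [hL]; positivity
  obtain ⟨hδ0, hδlt⟩ := hδ
  have hδH₁ : δ < H₁ := hδlt.trans_le (min_le_left _ _)
  have hδH₂ : δ < H₂ := hδlt.trans_le (min_le_right _ _)
  rw [hH₁] at hδH₁
  rw [hH₂] at hδH₂
  have q1 := lk_root hδ0 (by positivity) hμ hδH₁
  have q2 := lk_root hδ0 (by positivity) hμ hδH₂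
  rw [lt_min_iff, lt_min_iff, lt_div_iff₀ (by positivity), lt_div_iff₀ (by positivity),
    lt_div_iff₀ (by positivity)] at q2
  rw [lt_div_iff₀ (by positivity)] at q1
  obtain ⟨q2, q3, q4⟩ := q2
  have ha₁pos : 0 < a₁ := by rw [ha₁]; linarith
  have ha₁k : a₁ ≤ k₀ := by
    rw [ha₁]
    have : 0 ≤ h * k₂ * m * (1 + χ ^ (-(2 * μ))) * δ ^ (μ - 1) := by positivity
    linarith
  have hk : k₀ ≤ k₁ := by
    have h1 := (hVlb (EuclideanSpace.single ⟨0, hn⟩ 1)).trans (hVub _)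
    simpa using h1
  have hβpos : 0 < β := by rw [hβ]; positivity
  have hΔδ : Δ < δ := by
    by_contra hcon
    push Not at hcon
    have h1 : δ ^ γ ≤ Δ ^ γ := by gcongr
    have h2 : 0 < β * Δ ^ (γ + μ - 1) := by positivity
    have h3 : a₁ * δ ^ γ ≤ k₁ * Δ ^ γ := by
      have : 0 ≤ δ ^ γ := by positivity
      exact mul_le_mul (by linarith) h1 this hk₁.le
    linarith
  -- clamped trajectory
  set y : ℝ → EuclideanSpace ℝ (Fin n) := fun t => x (max t (-h)) with hydef
  have hyx : ∀ t, -h ≤ t → y t = x t := fun t ht => by simp only [hydef]; rw [max_eq_left ht]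
  have hy : Continuous y :=
    hxc.comp_continuous (by fun_prop) (fun t => Set.mem_Ici.2 (le_max_right _ _))
  have hyd : ∀ t > 0, HasDerivAt y (f (y t, y (t - h))) t := by
    intro t ht
    rw [hyx t (by linarith), hyx (t - h) (by linarith)]
    refine (hxd t ht).congr_of_eventuallyEq ?_
    filter_upwards [Ioi_mem_nhds ht] with s hs
    exact hyx s (by linarith [Set.mem_Ioi.1 hs])
  -- initial bound
  set r := ⨆ θ : Set.Icc (-h) (0:ℝ), ‖φ θ.1‖ with hr
  have hbdd : BddAbove (Set.range fun θ : Set.Icc (-h) (0:ℝ) => ‖φ θ.1‖) := by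
    obtain ⟨C, hC⟩ := isCompact_Icc.exists_bound_of_continuousOn hφc
    exact ⟨C, by rintro _ ⟨θ, rfl⟩; exact hC θ.1 θ.2⟩
  have hinit : ∀ s ∈ Set.Icc (-h) (0:ℝ), ‖y s‖ ≤ r := by
    intro s hs
    rw [hyx s hs.1, hxφ s hs]
    exact le_ciSup hbdd ⟨s, hs⟩
  have hr0 : 0 ≤ r := (norm_nonneg _).trans (hinit 0 ⟨by linarith, le_rfl⟩)
  set v := lkV h w₁ w₂ (γ + μ - 1) V (gradient V) f y with hv
  have hGcont : Continuous (gradient V) := by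
    have h1 : ContDiff ℝ 1 (fderiv ℝ V) := hV.fderiv_right (by norm_num)
    exact ((InnerProductSpace.toDual ℝ (EuclideanSpace ℝ (Fin n))).symm.contDiff.comp h1).continuous
  have hvc : Continuous v := lkV_cont hp0 hV.continuous hGcont hf.continuous hy
  have hv0 : v 0 < a₁ * δ ^ γ := by
    have h1 := lkV_upper (w₁ := w₁) (w₂ := w₂) (y := y) (t := 0) (r := r) hh hμ hm hγ hk₁ hk₂ hw₁ hw₂
      hfb hVub hgrad (by intro s hs; exact hinit s (by simpa using hs))
    rw [← hβ, ← hv] at h1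
    have h2 : r ^ γ < Δ ^ γ := Real.rpow_lt_rpow hr0 hφΔ (by linarith)
    have h3 : r ^ (γ + μ - 1) ≤ Δ ^ (γ + μ - 1) := by gcongr
    have h4 := mul_lt_mul_of_pos_left h2 hk₁
    have h5 := mul_le_mul_of_nonneg_left h3 hβpos.le
    linarith
  have hvl : ∀ t, ‖y t‖ ≤ δ → a₁ * ‖y t‖ ^ γ ≤ v t := by
    intro t ht
    rw [ha₁]
    exact lkV_lower hh hμ hm hγ hk₂ hw₂ hχ (by rw [← ha₂]; exact ha₂pos) hf.continuous hfb hVlb hgrad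
      hy ht
  set ε := w - w₁ - h * w₂ - 4 * h * L * δ ^ (μ - 1) with hε
  have hεpos : 0 < ε := by rw [hε, ← hw₀]; linarith
  have hvd : ∀ t > 0, (∀ s ∈ Set.Icc (t - h) t, ‖y s‖ ≤ δ) →
      ∃ D, HasDerivAt v D t ∧ D ≤ -ε * ‖y t‖ ^ (γ + μ - 1) := by
    intro t ht hs
    exact lkV_deriv hh hμ hm hm₁ hγ hk₂ hk₃ hf hfb hfx hV hgrad hhess hdV hL (by linarith)
      (by linarith) hy hyd ht hs
  have hanti : ∀ T, (∀ s ∈ Set.Icc 0 T, ‖y s‖ ≤ δ) → AntitoneOn v (Set.Icc 0 T) := by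
    intro T hT
    have key : ∀ t ∈ interior (Set.Icc 0 T), ∃ D, HasDerivAt v D t ∧ D ≤ 0 := by
      intro t ht
      rw [interior_Icc] at ht
      obtain ⟨D, hD, hD'⟩ := hvd t ht.1 (by
        intro s hs
        rcases le_total s 0 with h0 | h0
        · exact (hinit s ⟨by linarith [hs.1, ht.1], h0⟩).trans (by linarith)
        · exact hT s ⟨h0, hs.2.trans ht.2.le⟩)
      refine ⟨D, hD, hD'.trans ?_⟩
      have : 0 ≤ ε * ‖y t‖ ^ (γ + μ - 1) := by positivity
      linarith
    refine antitoneOn_of_deriv_nonpos (convex_Icc 0 T) hvc.continuousOn ?_ ?_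
    · intro t ht
      obtain ⟨D, hD, -⟩ := key t ht
      exact hD.differentiableAt.differentiableWithinAt
    · intro t ht
      obtain ⟨D, hD, hD'⟩ := key t ht
      rwa [hD.deriv]
  have hy0 : ‖y 0‖ < δ := (hinit 0 ⟨by linarith, le_rfl⟩).trans_lt (by linarith)
  have hyn : Continuous fun t => ‖y t‖ := hy.norm
  have claim1 : ∀ t ≥ 0, ‖y t‖ < δ := by
    by_contra hcon
    push Not at hcon
    obtain ⟨t1, ht1, hbad⟩ := hcon
    have hne : ({t | t ∈ Set.Icc 0 t1 ∧ ‖y t‖ = δ}).Nonempty := by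
      obtain ⟨c, hc, hc'⟩ := intermediate_value_Icc ht1 hyn.continuousOn ⟨hy0.le, hbad⟩
      exact ⟨c, hc, hc'⟩
    have hcomp : IsCompact {t | t ∈ Set.Icc 0 t1 ∧ ‖y t‖ = δ} :=
      isCompact_Icc.inter_right (isClosed_eq hyn continuous_const)
    obtain ⟨T, ⟨hT, hTδ⟩, hmin⟩ := hcomp.exists_isLeast hne
    have hT' : ∀ s ∈ Set.Icc 0 T, ‖y s‖ ≤ δ := by
      intro s hs
      by_contra hcon
      push Not at hcon
      obtain ⟨c, hc, hc'⟩ := intermediate_value_Icc hs.1 hyn.continuousOn ⟨hy0.le, hcon.le⟩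
      have h1 : T ≤ c := hmin ⟨⟨hc.1, hc.2.trans (hs.2.trans hT.2)⟩, hc'⟩
      have h2 : s = T := le_antisymm hs.2 (h1.trans hc.2)
      rw [h2, hTδ] at hcon
      exact lt_irrefl _ hcon
    have h1 := hanti T hT' ⟨le_rfl, hT.1⟩ ⟨hT.1, le_rfl⟩ hT.1
    have h2 := hvl T hTδ.le
    rw [hTδ] at h2
    linarith
  refine ⟨fun t ht => by rw [← hyx t (by linarith)]; exact claim1 t ht, ?_⟩
  have hwin : ∀ t > 0, ∀ s ∈ Set.Icc (t - h) t, ‖y s‖ ≤ δ := by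
    intro t ht s hs
    rcases le_total s 0 with h0 | h0
    · exact (hinit s ⟨by linarith [hs.1], h0⟩).trans (by linarith)
    · exact (claim1 s h0).le
  -- the functional converges
  obtain ⟨l, hl⟩ : ∃ l, Filter.Tendsto v Filter.atTop (nhds l) := by
    have hA : Antitone fun t => v (max t 0) := by
      intro a b hab
      have h0 : (0:ℝ) ≤ max b 0 := le_max_right _ _
      exact hanti (max b 0) (fun s hs => (claim1 s hs.1).le)
        ⟨le_max_right _ _, max_le_max_right 0 hab⟩ ⟨h0, le_rfl⟩ (max_le_max_right 0 hab)
    have hB : BddBelow (Set.range fun t => v (max t 0)) := by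
      refine ⟨0, ?_⟩
      rintro _ ⟨t, rfl⟩
      refine le_trans ?_ (hvl (max t 0) (claim1 _ (le_max_right _ _)).le)
      positivity
    refine ⟨_, (tendsto_atTop_ciInf hA hB).congr' ?_⟩
    filter_upwards [Filter.eventually_ge_atTop 0] with t ht
    rw [max_eq_left ht]
  have hylim : Filter.Tendsto y Filter.atTop (nhds 0) := by
    rw [tendsto_zero_iff_norm_tendsto_zero, Metric.tendsto_nhds]
    intro η hη
    set C := m * (δ ^ μ + δ ^ μ) with hC
    have hCpos : 0 < C := by positivity
    set τ := η / (2 * C) with hτ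
    have hτpos : 0 < τ := by positivity
    have hcpos : 0 < ε * (η / 2) ^ (γ + μ - 1) * τ := by positivity
    have hdiff : Filter.Tendsto (fun t => v t - v (t + τ)) Filter.atTop (nhds (l - l)) :=
      hl.sub (hl.comp (Filter.tendsto_atTop_add_const_right _ τ Filter.tendsto_id))
    rw [sub_self] at hdiff
    filter_upwards [hdiff.eventually (gt_mem_nhds hcpos), Filter.eventually_gt_atTop 0] with t ht ht0
    rw [Real.dist_eq, sub_zero, abs_norm]
    by_contra hcon
    push Not at hcon
    have hlow : ∀ s ∈ Set.Icc t (t + τ), η / 2 ≤ ‖y s‖ := by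
      intro s hs
      have h1 : ‖y s - y t‖ ≤ C * ‖s - t‖ := by
        refine (convex_Icc t (t + τ)).norm_image_sub_le_of_norm_hasDerivWithin_le
          (f' := fun u => f (y u, y (u - h)))
          (fun u hu => (hyd u (by linarith [hu.1])).hasDerivWithinAt) ?_ ⟨le_rfl, by linarith⟩ hs
        intro u hu
        have hu0 : 0 < u := by linarith [hu.1]
        have e1 := hwin u hu0 u ⟨by linarith, le_rfl⟩
        have e2 := hwin u hu0 (u - h) ⟨le_rfl, by linarith⟩
        refine (hfb _ _).trans ?_
        rw [hC]
        gcongr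
      have h2 : C * ‖s - t‖ ≤ η / 2 := by
        rw [Real.norm_eq_abs, abs_of_nonneg (by linarith [hs.1])]
        calc C * (s - t) ≤ C * τ := by gcongr; linarith [hs.2]
          _ = η / 2 := by rw [hτ]; field_simp
      have h3 : ‖y t‖ ≤ ‖y s‖ + ‖y s - y t‖ := by
        have := norm_sub_norm_le (y t) (y s)
        rw [norm_sub_rev] at this
        linarith
      linarith
    have hdec : v (t + τ) - v t ≤ -(ε * (η / 2) ^ (γ + μ - 1)) * (t + τ - t) := by
      have key : ∀ s ∈ interior (Set.Icc t (t + τ)), ∃ D, HasDerivAt v D s ∧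
          D ≤ -(ε * (η / 2) ^ (γ + μ - 1)) := by
        intro s hs
        have hs' := interior_subset hs
        have hs0 : 0 < s := by linarith [hs'.1]
        obtain ⟨D, hD, hD'⟩ := hvd s hs0 (hwin s hs0)
        refine ⟨D, hD, hD'.trans ?_⟩
        have h1 : (η / 2) ^ (γ + μ - 1) ≤ ‖y s‖ ^ (γ + μ - 1) :=
          Real.rpow_le_rpow (by positivity) (hlow s hs') hp0.le
        have h2 := mul_le_mul_of_nonneg_left h1 hεpos.le
        linarith
      refine (convex_Icc t (t + τ)).image_sub_le_mul_sub_of_deriv_le hvc.continuousOn ?_ ?_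
        t ⟨le_rfl, by linarith⟩ (t + τ) ⟨by linarith, le_rfl⟩ (by linarith)
      · intro s hs
        obtain ⟨D, hD, -⟩ := key s hs
        exact hD.differentiableAt.differentiableWithinAt
      · intro s hs
        obtain ⟨D, hD, hD'⟩ := key s hs
        rwa [hD.deriv]
    rw [add_sub_cancel_left] at hdec
    linarith
  refine hylim.congr' ?_
  filter_upwards [Filter.eventually_ge_atTop 0] with t ht
  exact hyx t (by linarith)
end

section
/- Let χ > 0 be such that a₂ := w₁ − k₂ m χ^{2(γ−1)} > 0, let L = m m₁ k₂ + m² k₃, H₁ = (k₀/(h k₂ m (1 + χ^{−2μ})))^{1/(μ−1)}, H₂ = (min{w₀/(4hL), w₁/(2hL), w₂/(2L)})^{1/(μ−1)}, and let δ ∈ (0, min{H₁, H₂}). Set a₁ = k₀ − h k₂ m (1 + χ^{−2μ}) δ^{μ−1}, β = (2 k₂ m + w₁ + h w₂)·h, b = max{k₁ + 2 h m k₂ δ^{μ−1}, (m k₂ + w₁ + h w₂)δ^{μ−1}}, c = min{w₀ − 4hLδ^{μ−1}, w₂ − 2Lδ^{μ−1}}, and let Δ > 0 be a root of k₁Δ^γ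 + βΔ^{γ+μ−1} = a₁δ^γ. Define ĉ₁ = ((k₁ + βΔ^{μ−1})/a₁)^{1/γ} and ĉ₂ = (c/b)·((μ−1)/γ)·((k₁ + βΔ^{μ−1})/(2b·max{1,h}))^{(μ−1)/γ}. Then every solution x of the delay system with initial function φ satisfying ‖φ‖_h < Δ obeys ‖x(t)‖ ≤ ĉ₁‖φ‖_h·(1 + ĉ₂‖φ‖_h^{μ−1}·t)^{−1/(μ−1)} for all t ≥ 0. -/
open Real Set RealInnerProductSpace
open Filter Topology MeasureTheory

lemma lk_leibniz_s4 {E : Type*} [NormedAddCommGroup E] [NormedSpace ℝ E] [FiniteDimensional ℝ E]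
    (f : E × E → E) (hf : ContDiff ℝ 1 f) (y : ℝ → E) (hy : Continuous y) (h t : ℝ) (v : E)
    (hd : HasDerivAt y v t) :
    HasDerivAt (fun τ => ∫ s in (τ - h)..τ, f (y τ, y s))
      ((∫ s in (t-h)..t, (fderiv ℝ (fun x' => f (x', y s)) (y t)) v)
        + (f (y t, y t) - f (y t, y (t - h)))) t := by
  have : ProperSpace E := FiniteDimensional.proper ℝ E
  have hfc : Continuous f := hf.continuous
  set D : E → ℝ → E →L[ℝ] E := fun z s => (fderiv ℝ f (z, y s)).comp (ContinuousLinearMap.inl ℝ E E)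
    with hD
  have hDd : ∀ z s, HasFDerivAt (fun x' => f (x', y s)) (D z s) z := by
    intro z s
    have h1 : HasFDerivAt f (fderiv ℝ f (z, y s)) (z, y s) :=
      (hf.differentiable (by norm_num) _).hasFDerivAt
    exact h1.comp z (hasFDerivAt_prodMk_left z (y s))
  have hDc : Continuous (Function.uncurry D) := by
    have h1 : Continuous (fderiv ℝ f) := hf.continuous_fderiv (by norm_num)
    have : Continuous fun p : E × ℝ => fderiv ℝ f (p.1, y p.2) := by fun_prop
    exact this.clm_comp continuous_const
  -- derivative in z
  have hz : ∀ (z : E) (u : ℝ), HasFDerivAt (fun z' => ∫ s in (0:ℝ)..u, f (z', y s))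
      (∫ s in (0:ℝ)..u, D z s) z := by
    intro z u
    have hK : IsCompact (Metric.closedBall z 1 ×ˢ uIcc (0:ℝ) u) :=
      (isCompact_closedBall z 1).prod isCompact_uIcc
    obtain ⟨C, hC⟩ := hK.exists_bound_of_continuousOn hDc.continuousOn
    refine intervalIntegral.hasFDerivAt_integral_of_dominated_of_fderiv_le
      (F := fun z' s => f (z', y s)) (F' := D) (bound := fun _ => C)
      (s := Metric.closedBall z 1) (Metric.closedBall_mem_nhds z one_pos) ?_ ?_ ?_ ?_ ?_ ?_
    · refine Eventually.of_forall fun z' => ?_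
      exact (by fun_prop : Continuous fun s => f (z', y s)).aestronglyMeasurable
    · exact (by fun_prop : Continuous fun s => f (z, y s)).intervalIntegrable _ _
    · exact (hDc.comp (Continuous.prodMk_right z)).aestronglyMeasurable
    · refine Eventually.of_forall fun s hs z' hz' => ?_
      exact hC (z', s) ⟨hz', uIoc_subset_uIcc hs⟩
    · exact continuous_const.intervalIntegrable _ _
    · exact Eventually.of_forall fun s hs z' hz' => hDd z' s
  have hu : ∀ (z : E) (u : ℝ), HasFDerivAt (fun u' => ∫ s in (0:ℝ)..u', f (z, y s))
      (ContinuousLinearMap.toSpanSingleton ℝ (f (z, y u))) u := by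
    intro z u
    have hc : Continuous fun s => f (z, y s) := by fun_prop
    have := intervalIntegral.integral_hasDerivAt_right (hc.intervalIntegrable 0 u)
      (hc.stronglyMeasurableAtFilter _ _) hc.continuousAt
    exact this.hasFDerivAt
  have hPhi : ∀ z u, HasFDerivAt (fun p : E × ℝ => ∫ s in (0:ℝ)..p.2, f (p.1, y s))
      ((∫ s in (0:ℝ)..u, D z s).coprod (ContinuousLinearMap.toSpanSingleton ℝ (f (z, y u)))) (z, u) := by
    intro z u
    have := hasStrictFDerivAt_uncurry_coprod (𝕜 := ℝ) (u := (z, u))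
      (f := fun z' u' => ∫ s in (0:ℝ)..u', f (z', y s))
      (f₁ := fun z' u' => ∫ s in (0:ℝ)..u', D z' s)
      (f₂ := fun z' u' => ContinuousLinearMap.toSpanSingleton ℝ (f (z', y u')))
      (Eventually.of_forall fun v => hz v.1 v.2) (Eventually.of_forall fun v => hu v.1 v.2)
      (intervalIntegral.continuous_parametric_primitive_of_continuous hDc).continuousAt
      (by
        have : Continuous fun p : E × ℝ => ContinuousLinearMap.toSpanSingletonCLE (𝕜 := ℝ) (f (p.1, y p.2)) := by fun_prop
        exact this.continuousAt)
    exact this.hasFDerivAt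
  have e1 := HasFDerivAt.comp_hasDerivAt (f := fun τ => (y τ, τ)) t (hPhi (y t) t) (hd.prodMk (hasDerivAt_id t))
  have e2 := HasFDerivAt.comp_hasDerivAt (f := fun τ => (y τ, τ - h)) t (hPhi (y t) (t - h)) (hd.prodMk ((hasDerivAt_id t).sub_const h))
  have e3 := e1.sub e2
  have hci : ∀ z a b, IntervalIntegrable (fun s => f (z, y s)) volume a b := fun z a b =>
    (by fun_prop : Continuous fun s => f (z, y s)).intervalIntegrable _ _
  have hcD : ∀ z a b, IntervalIntegrable (fun s => D z s) volume a b := fun z a b =>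
    (hDc.comp (Continuous.prodMk_right z)).intervalIntegrable _ _
  convert e3 using 1
  · funext τ
    simp only [Pi.sub_apply, Function.comp]
    exact (intervalIntegral.integral_interval_sub_left (hci _ _ _) (hci _ _ _)).symm
  · simp only [ContinuousLinearMap.coprod_apply, ContinuousLinearMap.toSpanSingleton_apply, one_smul]
    have : ∫ s in (t-h)..t, (fderiv ℝ (fun x' => f (x', y s)) (y t)) v
        = (∫ s in (0:ℝ)..t, D (y t) s) v - (∫ s in (0:ℝ)..(t-h), D (y t) s) v := by
      rw [← sub_apply,
        intervalIntegral.integral_interval_sub_left (hcD _ _ _) (hcD _ _ _),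
        ContinuousLinearMap.intervalIntegral_apply (hcD _ _ _)]
      refine intervalIntegral.integral_congr fun s _ => ?_
      simp only [(hDd (y t) s).fderiv]
    rw [this]
    abel

lemma lk_compare (v v' : ℝ → ℝ) (r K A : ℝ) (hr : 0 < r) (hK : 0 ≤ K) (hA : 0 < A)
    (hvc : ContinuousOn v (Ici 0)) (hvd : ∀ t > 0, HasDerivAt v (v' t) t)
    (hv0 : ∀ t ≥ 0, 0 ≤ v t) (hle : ∀ t > 0, v' t ≤ - K * (v t) ^ (1 + r))
    (hA0 : v 0 ≤ A) : ∀ t ≥ 0, v t ≤ A * (1 + r * K * A ^ r * t) ^ (-(1 / r)) := by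
  have hanti : AntitoneOn v (Ici 0) := by
    refine antitoneOn_of_hasDerivWithinAt_nonpos (f' := v') (convex_Ici 0) hvc ?_ ?_
    · intro t ht
      rw [interior_Ici] at ht
      exact (hvd t ht).hasDerivWithinAt
    · intro t ht
      rw [interior_Ici] at ht
      have := hle t ht
      have h2 : 0 ≤ K * (v t) ^ (1 + r) := mul_nonneg hK (rpow_nonneg (hv0 t (le_of_lt ht)) _)
      linarith
  intro T hT
  have hAr : 0 < A ^ r := rpow_pos_of_pos hA _
  have hden : 0 < 1 + r * K * A ^ r * T := by positivity
  rcases (hv0 T hT).eq_or_lt with h0 | hpos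
  · rw [← h0]; positivity
  have hvpos : ∀ t ∈ Icc 0 T, 0 < v t := fun t ht =>
    lt_of_lt_of_le hpos (hanti ht.1 hT ht.2)
  have hmono : MonotoneOn (fun t => (v t) ^ (-r) - r * K * t) (Icc 0 T) := by
    refine monotoneOn_of_hasDerivWithinAt_nonneg
      (f' := fun t => v' t * (-r) * (v t) ^ (-r - 1) - r * K) (convex_Icc 0 T) ?_ ?_ ?_
    · refine ContinuousOn.sub ?_ (by fun_prop)
      refine ContinuousOn.rpow_const (hvc.mono Icc_subset_Ici_self) ?_
      intro t ht; exact Or.inl (hvpos t ht).ne'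
    · intro t ht
      rw [interior_Icc] at ht
      have h1 := (hvd t ht.1).rpow_const (p := -r) (Or.inl (hvpos t (Ioo_subset_Icc_self ht)).ne')
      have h2 := (hasDerivAt_id t).const_mul (r * K)
      have h3 := (h1.sub h2).hasDerivWithinAt (s := Ioo 0 T)
      rw [mul_one] at h3
      rw [interior_Icc]
      exact h3
    · intro t ht
      rw [interior_Icc] at ht
      have hp := hvpos t (Ioo_subset_Icc_self ht)
      have h1 := hle t ht.1
      have h3 : (v t) ^ (1 + r) * (v t) ^ (-r - 1) = 1 := by
        rw [← rpow_add hp, show 1 + r + (-r - 1) = 0 by ring, rpow_zero]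
      have h4 : 0 < (v t) ^ (-r - 1) := rpow_pos_of_pos hp _
      have h5 : r * K = r * K * ((v t) ^ (1 + r) * (v t) ^ (-r - 1)) := by rw [h3, mul_one]
      have h6 : (K * (v t) ^ (1 + r)) * (r * (v t) ^ (-r - 1)) ≤ (-v' t) * (r * (v t) ^ (-r - 1)) :=
        mul_le_mul_of_nonneg_right (by linarith) (by positivity)
      have : 0 ≤ v' t * (-r) * (v t) ^ (-r - 1) - r * K := by rw [h5]; linarith
      exact this
  have h1 := hmono (left_mem_Icc.2 hT) (right_mem_Icc.2 hT) hT
  simp only [mul_zero, sub_zero] at h1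
  have h2 : A ^ (-r) ≤ (v 0) ^ (-r) :=
    rpow_le_rpow_of_nonpos (hvpos 0 (left_mem_Icc.2 hT)) hA0 (by linarith)
  have h3 : A ^ (-r) * (1 + r * K * A ^ r * T) ≤ (v T) ^ (-r) := by
    have : A ^ (-r) * A ^ r = 1 := by rw [← rpow_add hA]; simp
    have : A ^ (-r) * (1 + r * K * A ^ r * T) = A ^ (-r) + r * K * T * (A ^ (-r) * A ^ r) := by ring
    rw [this, ‹A ^ (-r) * A ^ r = 1›]
    linarith
  have h4 := rpow_le_rpow_of_nonpos (z := -(1/r)) (by positivity) h3 (by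
    have : 0 < 1 / r := by positivity
    linarith)
  rw [mul_rpow (by positivity) hden.le, ← rpow_mul hA.le, ← rpow_mul hpos.le] at h4
  have : -r * -(1 / r) = 1 := by field_simp
  rwa [this, rpow_one, rpow_one] at h4

lemma lk_power (g : ℝ → ℝ) (hg : Continuous g) (hg0 : ∀ s, 0 ≤ g s) (A h t q : ℝ) (hh : 0 < h)
    (hA : 0 ≤ A) (hq : 1 ≤ q) :
    (A + ∫ s in (t-h)..t, g s) ^ q ≤ (2 * max 1 h) ^ (q - 1) *
      (A ^ q + ∫ s in (t-h)..t, (g s) ^ q) := by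
  have hth : t - h ≤ t := by linarith
  have hI0 : 0 ≤ ∫ s in (t-h)..t, g s := intervalIntegral.integral_nonneg hth fun s _ => hg0 s
  have hgq : Continuous fun s => g s ^ q := hg.rpow_const (fun s => Or.inr (by linarith))
  have hIq0 : 0 ≤ ∫ s in (t-h)..t, (g s) ^ q :=
    intervalIntegral.integral_nonneg hth fun s _ => rpow_nonneg (hg0 s) _
  have hvol : volume (Ioc (t-h) t) = ENNReal.ofReal h := by simp
  have hJ : (∫ s in (t-h)..t, g s) ^ q ≤ h ^ (q-1) * ∫ s in (t-h)..t, (g s) ^ q := by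
    have := ConvexOn.map_set_average_le (μ := volume) (t := Ioc (t-h) t) (f := g)
      (convexOn_rpow hq) (continuous_rpow_const (by linarith)).continuousOn isClosed_Ici
      (by simpa using hh) (by simp) (Eventually.of_forall fun s => hg0 s)
      (hg.integrableOn_Ioc) (hgq.integrableOn_Ioc)
    simp only [setAverage_eq, ← intervalIntegral.integral_of_le hth, Measure.real, hvol,
      ENNReal.toReal_ofReal hh.le, smul_eq_mul] at this
    rw [mul_rpow (by positivity) hI0] at this
    have h2 := mul_le_mul_of_nonneg_left this (rpow_nonneg hh.le q)
    rw [← mul_assoc, ← mul_rpow hh.le (by positivity), mul_inv_cancel₀ hh.ne', one_rpow, one_mul,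
      ← mul_assoc] at h2
    rwa [rpow_sub_one hh.ne', div_eq_mul_inv]
  have h1 : (A + ∫ s in (t-h)..t, g s) ^ q ≤ 2 ^ (q-1) * (A ^ q + (∫ s in (t-h)..t, g s) ^ q) := by
    have := NNReal.rpow_add_le_mul_rpow_add_rpow ⟨A, hA⟩ ⟨_, hI0⟩ hq
    exact_mod_cast this
  have hM1 : 1 ≤ (max 1 h) ^ (q-1) := one_le_rpow (le_max_left _ _) (by linarith)
  have hM2 : h ^ (q-1) ≤ (max 1 h) ^ (q-1) := rpow_le_rpow hh.le (le_max_right _ _) (by linarith)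
  rw [mul_rpow (by norm_num) (by positivity), mul_assoc]
  refine h1.trans (mul_le_mul_of_nonneg_left ?_ (by positivity))
  rw [mul_add]
  refine add_le_add ?_ (hJ.trans ?_)
  · exact le_mul_of_one_le_left (by positivity) hM1
  · exact mul_le_mul_of_nonneg_right hM2 hIq0

lemma lk_max_le (a b p : ℝ) (ha : 0 ≤ a) (hb : 0 ≤ b) : (max a b) ^ p ≤ a ^ p + b ^ p := by
  have := rpow_nonneg ha p
  have := rpow_nonneg hb p
  rcases max_choice a b with h | h <;> rw [h] <;> linarith

lemma lk_two (a s α κ : ℝ) (ha : 0 ≤ a) (hs : 0 ≤ s) (hα : 0 ≤ α) (hκ : 0 < κ) :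
    a ^ α * s ^ κ ≤ a ^ (α + κ) + s ^ (α + κ) := by
  refine le_trans ?_ (lk_max_le a s _ ha hs)
  have hM : 0 ≤ max a s := le_max_of_le_left ha
  rw [rpow_add_of_nonneg hM hα hκ.le]
  gcongr
  · exact le_max_left _ _
  · exact le_max_right _ _

lemma lk_chi (a s α κ χ : ℝ) (ha : 0 ≤ a) (hs : 0 ≤ s) (hα : 0 ≤ α) (hκ : 0 < κ) (hχ : 0 < χ) :
    a ^ α * s ^ κ ≤ χ ^ (-(2 * κ)) * a ^ (α + κ) + χ ^ (2 * α) * s ^ (α + κ) := by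
  have h1 : 0 ≤ χ ^ (-(2 * κ)) * a ^ (α + κ) := by positivity
  have h2 : 0 ≤ χ ^ (2 * α) * s ^ (α + κ) := by positivity
  have e2 : χ ^ (2 * α) = (χ ^ (2:ℝ)) ^ α := rpow_mul hχ.le _ _
  have e1 : χ ^ (-(2 * κ)) = (χ ^ (-2:ℝ)) ^ κ := by rw [← rpow_mul hχ.le]; ring_nf
  have e3 : χ ^ (-2:ℝ) * χ ^ (2:ℝ) = 1 := by rw [← rpow_add hχ]; simp
  rcases le_total a (χ ^ (2:ℝ) * s) with h | h
  · have : a ^ α * s ^ κ ≤ χ ^ (2 * α) * s ^ (α + κ) := by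
      rw [e2, rpow_add_of_nonneg hs hα hκ.le, ← mul_assoc, ← mul_rpow (by positivity) hs]
      gcongr
    linarith
  · have h' : s ≤ χ ^ (-2:ℝ) * a := by
      have := mul_le_mul_of_nonneg_left h (rpow_nonneg hχ.le (-2:ℝ))
      rwa [← mul_assoc, e3, one_mul] at this
    have : a ^ α * s ^ κ ≤ χ ^ (-(2 * κ)) * a ^ (α + κ) := by
      rw [e1, rpow_add_of_nonneg ha hα hκ.le, mul_left_comm, ← mul_rpow (by positivity) ha]
      gcongr
    linarith

lemma lk_three (a b s M δ α κ ν p e : ℝ) (ha : 0 ≤ a) (hb : 0 ≤ b) (hs : 0 ≤ s)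
    (haM : a ≤ M) (hbM : b ≤ M) (hsM : s ≤ M) (hMδ : M ≤ δ)
    (hα : 0 ≤ α) (hκ : 0 ≤ κ) (hν : 0 ≤ ν) (hp : 0 ≤ p) (he : 0 ≤ e) (hsum : α + κ + ν = e + p) :
    a ^ α * s ^ κ * b ^ ν ≤ δ ^ e * M ^ p := by
  have hM : 0 ≤ M := ha.trans haM
  calc a ^ α * s ^ κ * b ^ ν ≤ M ^ α * M ^ κ * M ^ ν := by gcongr
    _ = M ^ (e + p) := by
      rw [← rpow_add_of_nonneg hM hα hκ, ← rpow_add_of_nonneg hM (by linarith) hν, hsum]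
    _ = M ^ e * M ^ p := rpow_add_of_nonneg hM he hp
    _ ≤ δ ^ e * M ^ p := by gcongr

lemma lk_cross (a b s δ α κ ν p e : ℝ) (ha : 0 ≤ a) (hb : 0 ≤ b) (hs : 0 ≤ s)
    (haM : a ≤ δ) (hbM : b ≤ δ) (hsM : s ≤ δ)
    (hα : 0 ≤ α) (hκ : 0 ≤ κ) (hν : 0 ≤ ν) (hp : 0 ≤ p) (he : 0 ≤ e) (hsum : α + κ + ν = e + p) :
    a ^ α * (a ^ κ + s ^ κ) * (a ^ ν + b ^ ν) ≤ δ ^ e * (4 * a ^ p + 2 * b ^ p + 2 * s ^ p) := by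
  have hδ : 0 ≤ δ ^ e := rpow_nonneg (ha.trans haM) e
  have t1 := lk_three a a a a δ α κ ν p e ha ha ha le_rfl le_rfl le_rfl haM hα hκ hν hp he hsum
  have t2 := lk_three a a s (max a s) δ α κ ν p e ha ha hs (le_max_left _ _) (le_max_left _ _)
    (le_max_right _ _) (max_le haM hsM) hα hκ hν hp he hsum
  have t3 := lk_three a b a (max a b) δ α κ ν p e ha hb ha (le_max_left _ _) (le_max_right _ _)
    (le_max_left _ _) (max_le haM hbM) hα hκ hν hp he hsum
  have t4 := lk_three a b s (max a (max b s)) δ α κ ν p e ha hb hs (le_max_left _ _)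
    (le_max_of_le_right (le_max_left _ _)) (le_max_of_le_right (le_max_right _ _))
    (max_le haM (max_le hbM hsM)) hα hκ hν hp he hsum
  have m2 := mul_le_mul_of_nonneg_left (lk_max_le a s p ha hs) hδ
  have m3 := mul_le_mul_of_nonneg_left (lk_max_le a b p ha hb) hδ
  have m4 := mul_le_mul_of_nonneg_left ((lk_max_le a _ p ha (le_max_of_le_left hb)).trans
    (add_le_add_right (lk_max_le b s p hb hs) (a ^ p))) hδ
  have : a ^ α * (a ^ κ + s ^ κ) * (a ^ ν + b ^ ν) = a ^ α * a ^ κ * a ^ ν + a ^ α * s ^ κ * a ^ ν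
    + a ^ α * a ^ κ * b ^ ν + a ^ α * s ^ κ * b ^ ν := by ring
  rw [this]
  linarith

lemma lk_int {E : Type*} [NormedAddCommGroup E] [NormedSpace ℝ E]
    (F : ℝ → E) (g : ℝ → ℝ) (hg : Continuous g) (a b P : ℝ) (hab : a ≤ b)
    (hP : 0 ≤ P) (hb : ∀ s ∈ Icc a b, P * ‖F s‖ ≤ g s) :
    P * ‖∫ s in a..b, F s‖ ≤ ∫ s in a..b, g s := by
  have : P * ‖∫ s in a..b, F s‖ = ‖∫ s in a..b, P • F s‖ := by
    rw [intervalIntegral.integral_smul, norm_smul, Real.norm_of_nonneg hP]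
  rw [this]
  refine intervalIntegral.norm_integral_le_of_norm_le hab ?_ (hg.intervalIntegrable _ _)
  refine Eventually.of_forall fun s hs => ?_
  rw [norm_smul, Real.norm_of_nonneg hP]
  exact hb s (Ioc_subset_Icc_self hs)

lemma lk_functional {E : Type*} [NormedAddCommGroup E] [InnerProductSpace ℝ E]
    [FiniteDimensional ℝ E] [CompleteSpace E]
    (h μ : ℝ) (hh : 0 < h) (hμ : 1 < μ) (f : E × E → E) (hf : ContDiff ℝ 1 f)
    (m m₁ : ℝ) (hm : 0 < m) (hm₁ : 0 < m₁)
    (hfb : ∀ x y : E, ‖f (x, y)‖ ≤ m * (‖x‖ ^ μ + ‖y‖ ^ μ))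
    (hfx : ∀ x y : E,
      ‖fderiv ℝ (fun x' => f (x', y)) x‖ ≤ m₁ * (‖x‖ ^ (μ - 1) + ‖y‖ ^ (μ - 1)))
    (γ : ℝ) (hγ : 2 ≤ γ) (V : E → ℝ) (hV : ContDiff ℝ 2 V)
    (k₀ k₁ k₂ k₃ w : ℝ) (hk₁ : 0 < k₁) (hk₂ : 0 < k₂) (hk₃ : 0 < k₃)
    (hVlb : ∀ x : E, k₀ * ‖x‖ ^ γ ≤ V x)
    (hVub : ∀ x : E, V x ≤ k₁ * ‖x‖ ^ γ)
    (hgrad : ∀ x : E, ‖gradient V x‖ ≤ k₂ * ‖x‖ ^ (γ - 1))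
    (hhess : ∀ x : E, ‖fderiv ℝ (gradient V) x‖ ≤ k₃ * ‖x‖ ^ (γ - 2))
    (hdV : ∀ x : E, ⟪gradient V x, f (x, x)⟫ ≤ -w * ‖x‖ ^ (γ + μ - 1))
    (w₁ w₂ : ℝ) (hw₁ : 0 < w₁) (hw₂ : 0 < w₂) (χ L : ℝ) (hχ : 0 < χ)
    (hL : L = m * m₁ * k₂ + m ^ 2 * k₃)
    (y : ℝ → E) (hy : Continuous y) (hyd : ∀ t > 0, HasDerivAt y (f (y t, y (t - h))) t) :
    ∃ v v' : ℝ → ℝ, Continuous v ∧ (∀ t > 0, HasDerivAt v (v' t) t) ∧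
      (∀ t > 0, ∀ δ, (∀ s ∈ Icc (t - h) t, ‖y s‖ ≤ δ) →
        v' t ≤ -(w - w₁ - h * w₂ - 4 * h * L * δ ^ (μ - 1)) * ‖y t‖ ^ (γ + μ - 1)
          - (w₁ - 2 * h * L * δ ^ (μ - 1)) * ‖y (t - h)‖ ^ (γ + μ - 1)
          - (w₂ - 2 * L * δ ^ (μ - 1)) * ∫ s in (t-h)..t, ‖y s‖ ^ (γ + μ - 1)) ∧
      (∀ t, k₀ * ‖y t‖ ^ γ - h * k₂ * m * (1 + χ ^ (-(2 * μ))) * ‖y t‖ ^ (γ + μ - 1)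
        + (w₁ - k₂ * m * χ ^ (2 * (γ - 1))) * ∫ s in (t-h)..t, ‖y s‖ ^ (γ + μ - 1) ≤ v t) ∧
      (∀ t, v t ≤ k₁ * ‖y t‖ ^ γ + 2 * h * m * k₂ * ‖y t‖ ^ (γ + μ - 1)
        + (m * k₂ + w₁ + h * w₂) * ∫ s in (t-h)..t, ‖y s‖ ^ (γ + μ - 1)) ∧
      (∀ t N, (∀ s ∈ Icc (t - h) t, ‖y s‖ ≤ N) →
        v t ≤ k₁ * N ^ γ + (2 * k₂ * m + w₁ + h * w₂) * h * N ^ (γ + μ - 1)) := by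
  set p := γ + μ - 1 with hp
  have hp0 : 0 < p := by linarith
  have hfc : Continuous f := hf.continuous
  set ρ : ℝ → ℝ := fun s => ‖y s‖ ^ p with hρ
  have hρc : Continuous ρ := hy.norm.rpow_const (fun s => Or.inr hp0.le)
  have hρ0 : ∀ s, 0 ≤ ρ s := fun s => rpow_nonneg (norm_nonneg _) _
  have hth : ∀ t, t - h ≤ t := fun t => by linarith
  -- gradient facts
  have hgd : ContDiff ℝ 1 (gradient V) := by
    have : ContDiff ℝ 1 (fderiv ℝ V) := hV.fderiv_right (by norm_num)
    exact (InnerProductSpace.toDual ℝ E).symm.toContinuousLinearEquiv.contDiff.comp this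
  have hVg : ∀ z, HasFDerivAt V (InnerProductSpace.toDual ℝ E (gradient V z)) z := fun z =>
    ((hV.differentiable (by norm_num)) z).hasGradientAt.hasFDerivAt
  set G : ℝ → E := fun τ => ∫ s in (τ - h)..τ, f (y τ, y s) with hG
  set R : ℝ → ℝ := fun τ => ∫ s in (τ - h)..τ, ρ s with hR
  set S : ℝ → ℝ := fun τ => ∫ s in (τ - h)..τ, s * ρ s with hS
  set W : ℝ → ℝ := fun τ => (w₁ + (h - τ) * w₂) * R τ + w₂ * S τ with hW
  have hprim : ∀ (g : ℝ → ℝ), Continuous g → ∀ t,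
      HasDerivAt (fun τ => ∫ s in (τ - h)..τ, g s) (g t - g (t - h)) t := by
    intro g hg t
    have e1 := intervalIntegral.integral_hasDerivAt_right (hg.intervalIntegrable 0 t)
      (hg.stronglyMeasurableAtFilter _ _) hg.continuousAt
    have e2 := intervalIntegral.integral_hasDerivAt_right (hg.intervalIntegrable 0 (t - h))
      (hg.stronglyMeasurableAtFilter _ _) hg.continuousAt
    have e3 := e2.comp_sub_const t h
    refine (e1.sub e3).congr_of_eventuallyEq (Eventually.of_forall fun τ => ?_)
    exact (intervalIntegral.integral_interval_sub_left (hg.intervalIntegrable _ _)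
      (hg.intervalIntegrable _ _)).symm
  have hRd := hprim ρ hρc
  have hSd := hprim (fun s => s * ρ s) (by fun_prop)
  have hWd : ∀ t, HasDerivAt W (-w₂ * R t + (w₁ + h * w₂) * ρ t - w₁ * ρ (t - h)) t := by
    intro t
    have e1 : HasDerivAt (fun τ : ℝ => w₁ + (h - τ) * w₂) (-w₂) t := by
      have := (((hasDerivAt_id t).const_sub h).mul_const w₂).const_add w₁
      simpa using this
    have := (e1.mul (hRd t)).add ((hSd t).const_mul w₂)
    refine this.congr_deriv ?_
    ring
  have hWc : Continuous W := continuous_iff_continuousAt.2 fun t => (hWd t).continuousAt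
  have hWeq : ∀ t, W t = ∫ s in (t-h)..t, (w₁ + (h + s - t) * w₂) * ρ s := by
    intro t
    simp only [hW, hR, hS]
    rw [← intervalIntegral.integral_const_mul, ← intervalIntegral.integral_const_mul,
      ← intervalIntegral.integral_add]
    · refine intervalIntegral.integral_congr fun s _ => ?_
      ring
    · exact (by fun_prop : Continuous _).intervalIntegrable _ _
    · exact (by fun_prop : Continuous _).intervalIntegrable _ _
  have hWl : ∀ t, w₁ * R t ≤ W t := by
    intro t
    rw [hWeq]
    simp only [hR]
    rw [← intervalIntegral.integral_const_mul]
    refine intervalIntegral.integral_mono_on (hth t)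
      ((by fun_prop : Continuous _).intervalIntegrable _ _)
      ((by fun_prop : Continuous _).intervalIntegrable _ _) fun s hs => ?_
    refine mul_le_mul_of_nonneg_right ?_ (hρ0 s)
    have : 0 ≤ (h + s - t) * w₂ := mul_nonneg (by linarith [hs.1]) hw₂.le
    linarith
  have hWu : ∀ t, W t ≤ (w₁ + h * w₂) * R t := by
    intro t
    rw [hWeq]
    simp only [hR]
    rw [← intervalIntegral.integral_const_mul]
    refine intervalIntegral.integral_mono_on (hth t)
      ((by fun_prop : Continuous _).intervalIntegrable _ _)
      ((by fun_prop : Continuous _).intervalIntegrable _ _) fun s hs => ?_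
    refine mul_le_mul_of_nonneg_right ?_ (hρ0 s)
    have : (h + s - t) * w₂ ≤ h * w₂ := mul_le_mul_of_nonneg_right (by linarith [hs.2]) hw₂.le
    linarith
  have hGc : Continuous G := by
    have c1 : Continuous (Function.uncurry fun (τ : ℝ) s => f (y τ, y s)) := by
      simp only [Function.uncurry_def]
      fun_prop
    have e : G = fun τ => (∫ s in (0:ℝ)..τ, f (y τ, y s)) - ∫ s in (0:ℝ)..(τ-h), f (y τ, y s) := by
      funext τ
      have : Continuous fun s => f (y τ, y s) := by fun_prop
      exact (intervalIntegral.integral_interval_sub_left (this.intervalIntegrable _ _)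
        (this.intervalIntegrable _ _)).symm
    rw [e]
    exact (intervalIntegral.continuous_parametric_intervalIntegral_of_continuous c1
      continuous_id).sub (intervalIntegral.continuous_parametric_intervalIntegral_of_continuous c1
      (by fun_prop))
  set J : ℝ → E := fun t =>
    ∫ s in (t-h)..t, (fderiv ℝ (fun x' => f (x', y s)) (y t)) (f (y t, y (t - h))) with hJ
  -- estimate of the middle term
  have hmid : ∀ t (g : ℝ → ℝ), Continuous g →
      (∀ s ∈ Icc (t-h) t, k₂ * m * (‖y t‖ ^ p + ‖y t‖ ^ (γ - 1) * ‖y s‖ ^ μ) ≤ g s) →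
      |⟪gradient V (y t), G t⟫| ≤ ∫ s in (t-h)..t, g s := by
    intro t g hg hle
    refine (abs_real_inner_le_norm _ _).trans ?_
    refine lk_int _ g hg _ _ _ (hth t) (norm_nonneg _) fun s hs => ?_
    refine le_trans ?_ (hle s hs)
    have e : ‖y t‖ ^ p = ‖y t‖ ^ (γ - 1) * ‖y t‖ ^ μ := by
      rw [← rpow_add_of_nonneg (norm_nonneg _) (by linarith) (by linarith)]
      congr 1; rw [hp]; ring
    calc ‖gradient V (y t)‖ * ‖f (y t, y s)‖
        ≤ (k₂ * ‖y t‖ ^ (γ - 1)) * (m * (‖y t‖ ^ μ + ‖y s‖ ^ μ)) :=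
          mul_le_mul (hgrad _) (hfb _ _) (norm_nonneg _) (by positivity)
      _ = _ := by rw [e]; ring
  have hpe : γ - 1 + μ = p := by rw [hp]; ring
  refine ⟨fun t => V (y t) + ⟪gradient V (y t), G t⟫ + W t,
    fun t => ⟪gradient V (y t), f (y t, y (t - h))⟫ +
      (⟪gradient V (y t), J t + (f (y t, y t) - f (y t, y (t - h)))⟫
        + ⟪fderiv ℝ (gradient V) (y t) (f (y t, y (t - h))), G t⟫)
      + (-w₂ * R t + (w₁ + h * w₂) * ρ t - w₁ * ρ (t - h)), ?_, ?_, ?_, ?_, ?_, ?_⟩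
  · have := hV.continuous
    have := hgd.continuous
    fun_prop
  · intro t ht
    have d1 := (hVg (y t)).comp_hasDerivAt t (hyd t ht)
    have d2 := ((hgd.differentiable (by norm_num) (y t)).hasFDerivAt).comp_hasDerivAt t (hyd t ht)
    have d3 := lk_leibniz_s4 f hf y hy h t _ (hyd t ht)
    have d4 := d2.inner ℝ d3
    exact (d1.add d4).add (hWd t)
  · intro t ht δ hδ
    have hδt : ‖y t‖ ≤ δ := hδ t ⟨hth t, le_rfl⟩
    have hδh : ‖y (t-h)‖ ≤ δ := hδ (t-h) ⟨le_rfl, hth t⟩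
    have b1 : ∀ C : ℝ, ∫ s in (t-h)..t, C * (4 * ρ t + 2 * ρ (t-h) + 2 * ρ s) =
        C * (4 * h * ρ t + 2 * h * ρ (t - h) + 2 * R t) := by
      intro C
      rw [intervalIntegral.integral_const_mul, intervalIntegral.integral_add,
        intervalIntegral.integral_const_mul, intervalIntegral.integral_const]
      · simp only [smul_eq_mul, hR]; ring
      · exact continuous_const.intervalIntegrable _ _
      · exact (by fun_prop : Continuous _).intervalIntegrable _ _
    have i1 : ⟪gradient V (y t), J t⟫ ≤ (m * m₁ * k₂ * δ ^ (μ - 1)) *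
        (4 * h * ρ t + 2 * h * ρ (t - h) + 2 * R t) := by
      refine (real_inner_le_norm _ _).trans ?_
      rw [← b1]
      refine lk_int _ _ (by fun_prop) _ _ _ (hth t) (norm_nonneg _) fun s hs => ?_
      have q1 := (ContinuousLinearMap.le_opNorm (fderiv ℝ (fun x' => f (x', y s)) (y t))
        (f (y t, y (t - h)))).trans
        (mul_le_mul (hfx _ _) (hfb _ _) (norm_nonneg _) (by positivity))
      have q2 := mul_le_mul (hgrad (y t)) q1 (norm_nonneg _) (by positivity)
      have q3 := lk_cross ‖y t‖ ‖y (t-h)‖ ‖y s‖ δ (γ - 1) (μ - 1) μ p (μ - 1) (norm_nonneg _)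
        (norm_nonneg _) (norm_nonneg _) hδt hδh (hδ s hs) (by linarith) (by linarith)
        (by linarith) hp0.le (by linarith) (by rw [hp]; ring)
      have q4 := mul_le_mul_of_nonneg_left q3 (by positivity : 0 ≤ m * m₁ * k₂)
      refine q2.trans (le_trans (le_of_eq ?_) (q4.trans (le_of_eq ?_)))
      · ring
      · simp only [hρ]; ring
    have i2 : ⟪fderiv ℝ (gradient V) (y t) (f (y t, y (t - h))), G t⟫ ≤
        (m ^ 2 * k₃ * δ ^ (μ - 1)) * (4 * h * ρ t + 2 * h * ρ (t - h) + 2 * R t) := by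
      refine (real_inner_le_norm _ _).trans ?_
      rw [← b1]
      refine lk_int _ _ (by fun_prop) _ _ _ (hth t) (norm_nonneg _) fun s hs => ?_
      have q1 := (ContinuousLinearMap.le_opNorm (fderiv ℝ (gradient V) (y t))
        (f (y t, y (t - h)))).trans
        (mul_le_mul (hhess _) (hfb _ _) (norm_nonneg _) (by positivity))
      have q2 := mul_le_mul q1 (hfb (y t) (y s)) (norm_nonneg _) (by positivity)
      have q3 := lk_cross ‖y t‖ ‖y (t-h)‖ ‖y s‖ δ (γ - 2) μ μ p (μ - 1) (norm_nonneg _)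
        (norm_nonneg _) (norm_nonneg _) hδt hδh (hδ s hs) (by linarith) (by linarith)
        (by linarith) hp0.le (by linarith) (by rw [hp]; ring)
      have q4 := mul_le_mul_of_nonneg_left q3 (by positivity : 0 ≤ m ^ 2 * k₃)
      refine q2.trans (le_trans (le_of_eq ?_) (q4.trans (le_of_eq ?_)))
      · ring
      · simp only [hρ]; ring
    have i3 := hdV (y t)
    have e1 : ‖y t‖ ^ p = ρ t := rfl
    have e2 : ‖y (t-h)‖ ^ p = ρ (t-h) := rfl
    have e3 : ∫ s in (t-h)..t, ‖y s‖ ^ p = R t := rfl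
    rw [e1] at i3
    rw [e1, e2, e3]
    simp only [inner_add_right, inner_sub_right]
    rw [hL]
    linarith
  · intro t
    have e3 : ∫ s in (t-h)..t, ‖y s‖ ^ p = R t := rfl
    have := hmid t (fun s => k₂ * m * ((1 + χ ^ (-(2*μ))) * ρ t + χ ^ (2 * (γ - 1)) * ρ s))
      (by fun_prop) (fun s hs => by
        have := lk_chi ‖y t‖ ‖y s‖ (γ - 1) μ χ (norm_nonneg _) (norm_nonneg _) (by linarith)
          (by linarith) hχ
        rw [hpe] at this
        refine mul_le_mul_of_nonneg_left ?_ (by positivity)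
        simp only [hρ]
        linarith)
    rw [intervalIntegral.integral_const_mul, intervalIntegral.integral_add
      (continuous_const.intervalIntegrable _ _)
      ((by fun_prop : Continuous _).intervalIntegrable _ _),
      intervalIntegral.integral_const, intervalIntegral.integral_const_mul, smul_eq_mul] at this
    change |_| ≤ k₂ * m * (_ + _ * R t) at this
    have := (abs_le.1 this).1
    have := hWl t
    have := hVlb (y t)
    rw [e3]
    simp only [hρ] at *
    linarith
  · intro t
    have e3 : ∫ s in (t-h)..t, ‖y s‖ ^ p = R t := rfl
    have := hmid t (fun s => k₂ * m * (2 * ρ t + ρ s))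
      (by fun_prop) (fun s hs => by
        have := lk_two ‖y t‖ ‖y s‖ (γ - 1) μ (norm_nonneg _) (norm_nonneg _) (by linarith)
          (by linarith)
        rw [hpe] at this
        refine mul_le_mul_of_nonneg_left ?_ (by positivity)
        simp only [hρ]
        linarith)
    rw [intervalIntegral.integral_const_mul, intervalIntegral.integral_add
      (continuous_const.intervalIntegrable _ _) (hρc.intervalIntegrable _ _),
      intervalIntegral.integral_const, smul_eq_mul] at this
    change |_| ≤ k₂ * m * (_ + R t) at this
    have := (abs_le.1 this).2
    have := hWu t
    have := hVub (y t)
    rw [e3]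
    simp only [hρ] at *
    linarith
  · intro t N hN
    have hNt : ‖y t‖ ≤ N := hN t ⟨hth t, le_rfl⟩
    have hN0 : 0 ≤ N := (norm_nonneg _).trans hNt
    have := hmid t (fun s => k₂ * m * (2 * N ^ p))
      (by fun_prop) (fun s hs => by
        refine mul_le_mul_of_nonneg_left ?_ (by positivity)
        have e : N ^ p = N ^ (γ - 1) * N ^ μ := by
          rw [← rpow_add_of_nonneg hN0 (by linarith) (by linarith), hpe]
        have q1 : ‖y t‖ ^ p ≤ N ^ p := rpow_le_rpow (norm_nonneg _) hNt hp0.le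
        have q2 : ‖y t‖ ^ (γ - 1) * ‖y s‖ ^ μ ≤ N ^ (γ - 1) * N ^ μ :=
          mul_le_mul (rpow_le_rpow (norm_nonneg _) hNt (by linarith))
            (rpow_le_rpow (norm_nonneg _) (hN s hs) (by linarith)) (by positivity) (by positivity)
        linarith)
    rw [intervalIntegral.integral_const, smul_eq_mul] at this
    have := (abs_le.1 this).2
    have := hWu t
    have := hVub (y t)
    have q3 : k₁ * ‖y t‖ ^ γ ≤ k₁ * N ^ γ :=
      mul_le_mul_of_nonneg_left (rpow_le_rpow (norm_nonneg _) hNt (by linarith)) hk₁.le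
    have q4 : R t ≤ h * N ^ p := by
      have := intervalIntegral.integral_mono_on (μ := volume) (hth t) (hρc.intervalIntegrable _ _)
        ((continuous_const (y := N ^ p)).intervalIntegrable _ _)
        (fun s hs => rpow_le_rpow (norm_nonneg _) (hN s hs) hp0.le)
      rw [intervalIntegral.integral_const, smul_eq_mul] at this
      simp only [hR]
      linarith
    have q5 : (w₁ + h * w₂) * R t ≤ (w₁ + h * w₂) * (h * N ^ p) :=
      mul_le_mul_of_nonneg_left q4 (by positivity)
    linarith

/-- Krasovskii-based estimate of the solutions (Theorem 5):
`‖x(t)‖ ≤ ĉ₁‖φ‖_h (1 + ĉ₂‖φ‖_h^{μ-1} t)^{-1/(μ-1)}` for all `t ≥ 0`. -/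
theorem solution_estimate_LK
    {n : ℕ} (hn : 1 ≤ n)
    (h μ : ℝ) (hh : 0 < h) (hμ : 1 < μ)
    (f : EuclideanSpace ℝ (Fin n) × EuclideanSpace ℝ (Fin n) → EuclideanSpace ℝ (Fin n))
    (hf : ContDiff ℝ 1 f)
    (hhom : ∀ c > (0:ℝ), ∀ x y : EuclideanSpace ℝ (Fin n),
      f (c • x, c • y) = (c ^ μ) • f (x, y))
    (m m₁ : ℝ) (hm : 0 < m) (hm₁ : 0 < m₁)
    (hfb : ∀ x y : EuclideanSpace ℝ (Fin n), ‖f (x, y)‖ ≤ m * (‖x‖ ^ μ + ‖y‖ ^ μ))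
    (hfx : ∀ x y : EuclideanSpace ℝ (Fin n),
      ‖fderiv ℝ (fun x' => f (x', y)) x‖ ≤ m₁ * (‖x‖ ^ (μ - 1) + ‖y‖ ^ (μ - 1)))
    (γ : ℝ) (hγ : 2 ≤ γ)
    (V : EuclideanSpace ℝ (Fin n) → ℝ) (hV : ContDiff ℝ 2 V)
    (k₀ k₁ k₂ k₃ w : ℝ) (hk₀ : 0 < k₀) (hk₁ : 0 < k₁) (hk₂ : 0 < k₂) (hk₃ : 0 < k₃)
    (hw : 0 < w)
    (hVlb : ∀ x : EuclideanSpace ℝ (Fin n), k₀ * ‖x‖ ^ γ ≤ V x)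
    (hVub : ∀ x : EuclideanSpace ℝ (Fin n), V x ≤ k₁ * ‖x‖ ^ γ)
    (hgrad : ∀ x : EuclideanSpace ℝ (Fin n), ‖gradient V x‖ ≤ k₂ * ‖x‖ ^ (γ - 1))
    (hhess : ∀ x : EuclideanSpace ℝ (Fin n),
      ‖fderiv ℝ (gradient V) x‖ ≤ k₃ * ‖x‖ ^ (γ - 2))
    (hdV : ∀ x : EuclideanSpace ℝ (Fin n),
      ⟪gradient V x, f (x, x)⟫ ≤ -w * ‖x‖ ^ (γ + μ - 1))
    (w₀ w₁ w₂ : ℝ) (hw₁ : 0 < w₁) (hw₂ : 0 < w₂)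
    (hw₀ : w₀ = w - w₁ - h * w₂) (hw₀pos : 0 < w₀)
    (χ a₂ L H₁ H₂ δ a₁ β b c Δ c₁ c₂ : ℝ)
    (hχ : 0 < χ)
    (ha₂ : a₂ = w₁ - k₂ * m * χ ^ (2 * (γ - 1))) (ha₂pos : 0 < a₂)
    (hL : L = m * m₁ * k₂ + m ^ 2 * k₃)
    (hH₁ : H₁ = (k₀ / (h * k₂ * m * (1 + χ ^ (-(2 * μ))))) ^ (1 / (μ - 1)))
    (hH₂ : H₂ = (min (w₀ / (4 * h * L)) (min (w₁ / (2 * h * L)) (w₂ / (2 * L)))) ^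
      (1 / (μ - 1)))
    (hδ : δ ∈ Set.Ioo 0 (min H₁ H₂))
    (ha₁ : a₁ = k₀ - h * k₂ * m * (1 + χ ^ (-(2 * μ))) * δ ^ (μ - 1))
    (hβ : β = (2 * k₂ * m + w₁ + h * w₂) * h)
    (hb : b = max (k₁ + 2 * h * m * k₂ * δ ^ (μ - 1)) ((m * k₂ + w₁ + h * w₂) * δ ^ (μ - 1)))
    (hc : c = min (w₀ - 4 * h * L * δ ^ (μ - 1)) (w₂ - 2 * L * δ ^ (μ - 1)))
    (hΔpos : 0 < Δ) (hΔ : k₁ * Δ ^ γ + β * Δ ^ (γ + μ - 1) = a₁ * δ ^ γ)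
    (hc₁ : c₁ = ((k₁ + β * Δ ^ (μ - 1)) / a₁) ^ (1 / γ))
    (hc₂ : c₂ = (c / b) * ((μ - 1) / γ) *
      ((k₁ + β * Δ ^ (μ - 1)) / (2 * b * max 1 h)) ^ ((μ - 1) / γ))
    (φ x : ℝ → EuclideanSpace ℝ (Fin n)) (N : ℝ)
    (hφc : ContinuousOn φ (Set.Icc (-h) 0))
    (hxc : ContinuousOn x (Set.Ici (-h)))
    (hxφ : ∀ θ ∈ Set.Icc (-h) (0:ℝ), x θ = φ θ)
    (hxd : ∀ t > (0:ℝ), HasDerivAt x (f (x t, x (t - h))) t)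
    (hN : N = ⨆ θ : Set.Icc (-h) (0:ℝ), ‖φ θ.1‖)
    (hφΔ : N < Δ) :
    ∀ t ≥ (0:ℝ), ‖x t‖ ≤ c₁ * N * (1 + c₂ * N ^ (μ - 1) * t) ^ (-(1 / (μ - 1))) := by
  classical
  have hμ1 : 0 < μ - 1 := by linarith
  have hγ0 : 0 < γ := by linarith
  have hLpos : 0 < L := by rw [hL]; positivity
  -- the extended solution
  set y : ℝ → EuclideanSpace ℝ (Fin n) := fun s => x (max s (-h)) with hydef
  have hy : Continuous y := hxc.comp_continuous (by fun_prop) (fun s => mem_Ici.2 (le_max_right _ _))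
  have hyx : ∀ s, -h ≤ s → y s = x s := fun s hs => by simp only [hydef, max_eq_left hs]
  have hyd : ∀ t > 0, HasDerivAt y (f (y t, y (t - h))) t := by
    intro t ht
    rw [hyx t (by linarith), hyx (t - h) (by linarith)]
    refine (hxd t ht).congr_of_eventuallyEq ?_
    filter_upwards [Ioi_mem_nhds ht] with s hs
    exact hyx s (by have : 0 < s := hs; linarith)
  have hyN : ∀ s ∈ Icc (0 - h) 0, ‖y s‖ ≤ N := by
    intro s hs
    rw [zero_sub] at hs
    rw [hyx s hs.1, hxφ s hs, hN]
    have hbdd : BddAbove (range fun θ : Set.Icc (-h) (0:ℝ) => ‖φ θ.1‖) := by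
      obtain ⟨C, hC⟩ := isCompact_Icc.exists_bound_of_continuousOn hφc
      refine ⟨C, ?_⟩
      rintro _ ⟨θ, rfl⟩
      exact hC θ.1 θ.2
    exact le_ciSup hbdd ⟨s, hs⟩
  have hN0 : 0 ≤ N := (norm_nonneg _).trans (hyN 0 ⟨by linarith, le_rfl⟩)
  obtain ⟨v, v', hvc, hvd, hvder, hvlow, hvup, hvN⟩ := lk_functional h μ hh hμ f hf m m₁ hm hm₁
    hfb hfx γ hγ V hV k₀ k₁ k₂ k₃ w hk₁ hk₂ hk₃ hVlb hVub hgrad hhess hdV w₁ w₂ hw₁ hw₂ χ L hχ hL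
    y hy hyd
  -- constants
  obtain ⟨hδ0, hδm⟩ := hδ
  have hroot : ∀ X, 0 < X → δ < X ^ (1 / (μ - 1)) → δ ^ (μ - 1) < X := by
    intro X hX hlt
    have := rpow_lt_rpow hδ0.le hlt hμ1
    rwa [← rpow_mul hX.le, one_div_mul_cancel hμ1.ne', rpow_one] at this
  set d := δ ^ (μ - 1) with hd
  have hd0 : 0 < d := rpow_pos_of_pos hδ0 _
  have hB : 0 < h * k₂ * m * (1 + χ ^ (-(2 * μ))) := by positivity
  have hd1 : d < k₀ / (h * k₂ * m * (1 + χ ^ (-(2 * μ)))) :=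
    hroot _ (by positivity) (hH₁ ▸ hδm.trans_le (min_le_left _ _))
  have hd2 : d < min (w₀ / (4 * h * L)) (min (w₁ / (2 * h * L)) (w₂ / (2 * L))) := by
    refine hroot _ ?_ (hH₂ ▸ hδm.trans_le (min_le_right _ _))
    refine lt_min (by positivity) (lt_min (by positivity) (by positivity))
  rw [lt_min_iff, lt_min_iff] at hd2
  obtain ⟨hd2, hd3, hd4⟩ := hd2
  rw [lt_div_iff₀ (by positivity)] at hd1 hd2 hd3 hd4
  have ha₁pos : 0 < a₁ := by rw [ha₁]; linarith
  have hcpos : 0 < c := by rw [hc]; exact lt_min (by linarith) (by linarith)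
  have hc_1 : c ≤ w₀ - 4 * h * L * d := by rw [hc]; exact min_le_left _ _
  have hc_2 : c ≤ w₂ - 2 * L * d := by rw [hc]; exact min_le_right _ _
  have hb_1 : k₁ + 2 * h * m * k₂ * d ≤ b := by rw [hb]; exact le_max_left _ _
  have hb_2 : (m * k₂ + w₁ + h * w₂) * d ≤ b := by rw [hb]; exact le_max_right _ _
  have hbpos : 0 < b := lt_of_lt_of_le (by positivity) hb_1
  have hβpos : 0 < β := by rw [hβ]; positivity
  set p := γ + μ - 1 with hp
  have hp0 : 0 < p := by linarith
  have hpsplit : ∀ z : ℝ, 0 ≤ z → z ^ p = z ^ (μ - 1) * z ^ γ := by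
    intro z hz
    rw [← rpow_add_of_nonneg hz hμ1.le hγ0.le]; congr 1; rw [hp]; ring
  have hpδ : ∀ z : ℝ, 0 ≤ z → z ≤ δ → z ^ p ≤ d * z ^ γ := by
    intro z hz hzδ
    rw [hpsplit z hz]
    exact mul_le_mul_of_nonneg_right (rpow_le_rpow hz hzδ hμ1.le) (rpow_nonneg hz _)
  have hk01 : k₀ ≤ k₁ := by
    have : NeZero n := ⟨by omega⟩
    have e : ‖EuclideanSpace.single (0 : Fin n) (1:ℝ)‖ = 1 := by simp
    have h1 := (hVlb (EuclideanSpace.single (0 : Fin n) (1:ℝ))).trans (hVub _)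
    rw [e] at h1
    simpa using h1
  have hΔδ : Δ < δ := by
    by_contra hcon
    push Not at hcon
    have q1 : δ ^ γ ≤ Δ ^ γ := rpow_le_rpow hδ0.le hcon hγ0.le
    have q2 : 0 < δ ^ γ := rpow_pos_of_pos hδ0 _
    have q3 : 0 < β * Δ ^ p := by positivity
    have q4 : a₁ ≤ k₁ := by
      have : 0 < h * k₂ * m * (1 + χ ^ (-(2 * μ))) * d := by positivity
      linarith
    have q5 : a₁ * δ ^ γ ≤ k₁ * Δ ^ γ := mul_le_mul q4 q1 q2.le hk₁.le
    linarith
  have hR0 : ∀ t, 0 ≤ ∫ s in (t-h)..t, ‖y s‖ ^ p := fun t =>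
    intervalIntegral.integral_nonneg (by linarith) fun s _ => rpow_nonneg (norm_nonneg _) _
  have hlow : ∀ t, ‖y t‖ ≤ δ → a₁ * ‖y t‖ ^ γ ≤ v t := by
    intro t ht
    have q1 := hvlow t
    have q2 := mul_le_mul_of_nonneg_left (hpδ _ (norm_nonneg _) ht) hB.le
    have q3 : 0 ≤ (w₁ - k₂ * m * χ ^ (2 * (γ - 1))) * ∫ s in (t-h)..t, ‖y s‖ ^ p :=
      mul_nonneg (by rw [← ha₂]; exact ha₂pos.le) (hR0 t)
    have q4 : a₁ * ‖y t‖ ^ γ = k₀ * ‖y t‖ ^ γ -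
        h * k₂ * m * (1 + χ ^ (-(2 * μ))) * (d * ‖y t‖ ^ γ) := by rw [ha₁]; ring
    linarith
  have hder : ∀ t > 0, (∀ s ∈ Icc (t - h) t, ‖y s‖ ≤ δ) →
      v' t ≤ -c * (‖y t‖ ^ p + ∫ s in (t-h)..t, ‖y s‖ ^ p) := by
    intro t ht hs
    have q1 := hvder t ht δ hs
    have q0 : 0 ≤ ‖y t‖ ^ p := rpow_nonneg (norm_nonneg _) _
    have q2 : 0 ≤ (w₁ - 2 * h * L * d) * ‖y (t - h)‖ ^ p :=
      mul_nonneg (by linarith) (rpow_nonneg (norm_nonneg _) _)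
    have q3 := mul_le_mul_of_nonneg_right hc_1 q0
    have q4 := mul_le_mul_of_nonneg_right hc_2 (hR0 t)
    rw [← hw₀] at q1
    linarith
  have hder0 : ∀ t > 0, (∀ s ∈ Icc (t - h) t, ‖y s‖ ≤ δ) → v' t ≤ 0 := by
    intro t ht hs
    have q1 := hder t ht hs
    have q2 : 0 ≤ c * (‖y t‖ ^ p + ∫ s in (t-h)..t, ‖y s‖ ^ p) :=
      mul_nonneg hcpos.le (add_nonneg (rpow_nonneg (norm_nonneg _) _) (hR0 t))
    linarith
  have hdecr : ∀ T ≥ 0, (∀ s ∈ Ico 0 T, ‖y s‖ ≤ δ) → v T ≤ v 0 := by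
    intro T hT hs
    have hanti : AntitoneOn v (Icc 0 T) := by
      refine antitoneOn_of_hasDerivWithinAt_nonpos (f' := v') (convex_Icc 0 T) hvc.continuousOn ?_ ?_
      · intro t ht
        rw [interior_Icc] at ht
        exact (hvd t ht.1).hasDerivWithinAt
      · intro t ht
        rw [interior_Icc] at ht
        refine hder0 t ht.1 fun s hs' => ?_
        rcases le_total s 0 with h0 | h0
        · have := hyN s ⟨by linarith [hs'.1, ht.1], h0⟩
          linarith
        · exact hs s ⟨h0, lt_of_le_of_lt hs'.2 ht.2⟩
    exact hanti (left_mem_Icc.2 hT) (right_mem_Icc.2 hT) hT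
  have hv0N : v 0 ≤ k₁ * N ^ γ + β * N ^ p := by
    rw [hβ]; exact hvN 0 N hyN
  have hv0δ : v 0 < a₁ * δ ^ γ := by
    rw [← hΔ]
    have q1 : N ^ γ < Δ ^ γ := rpow_lt_rpow hN0 hφΔ hγ0
    have q2 : N ^ p < Δ ^ p := rpow_lt_rpow hN0 hφΔ hp0
    have q3 := mul_lt_mul_of_pos_left q1 hk₁
    have q4 := mul_lt_mul_of_pos_left q2 hβpos
    linarith
  -- invariance
  have hivt : ∀ t ≥ 0, δ ≤ ‖y t‖ → ∃ s ∈ Icc 0 t, ‖y s‖ = δ := by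
    intro t ht hδt
    have q := intermediate_value_Icc ht (f := fun s => ‖y s‖) hy.norm.continuousOn
    have h0 : ‖y 0‖ ≤ δ := by
      have := hyN 0 ⟨by linarith, le_rfl⟩
      linarith
    exact q ⟨h0, hδt⟩
  have hinv0 : ∀ t ≥ 0, ‖y t‖ < δ := by
    intro t ht
    by_contra hcon
    push Not at hcon
    obtain ⟨t₁, ht₁, hyt₁⟩ := hivt t ht hcon
    set Z : Set ℝ := Ici 0 ∩ {s | ‖y s‖ = δ} with hZ
    have hZc : IsClosed Z := isClosed_Ici.inter (isClosed_eq hy.norm continuous_const)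
    have hZne : Z.Nonempty := ⟨t₁, ht₁.1, hyt₁⟩
    have hZb : BddBelow Z := ⟨0, fun s hs => hs.1⟩
    have hT := hZc.csInf_mem hZne hZb
    set T := sInf Z with hTdef
    have hlt : ∀ s ∈ Ico 0 T, ‖y s‖ ≤ δ := by
      intro s hs
      by_contra hc'
      push Not at hc'
      obtain ⟨s', hs', hys'⟩ := hivt s hs.1 hc'.le
      have : T ≤ s' := csInf_le hZb ⟨hs'.1, hys'⟩
      linarith [hs'.2, hs.2]
    have q1 := hdecr T hT.1 hlt
    have hTδ : ‖y T‖ = δ := hT.2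
    have q2 := hlow T hTδ.le
    rw [hTδ] at q2
    linarith
  have hinv : ∀ t, -h ≤ t → ‖y t‖ ≤ δ := by
    intro t ht
    rcases le_total t 0 with h0 | h0
    · have := hyN t ⟨by linarith, h0⟩
      linarith
    · exact (hinv0 t h0).le
  have hvnn : ∀ t ≥ 0, 0 ≤ v t := fun t ht =>
    le_trans (by positivity) (hlow t (hinv0 t ht).le)
  -- differential inequality
  set r := (μ - 1) / γ with hr
  have hr0 : 0 < r := by positivity
  have hγr : γ * (1 + r) = p := by rw [hr, hp]; field_simp; ring
  set M := max 1 h with hM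
  have hM0 : 0 < M := lt_of_lt_of_le one_pos (le_max_left _ _)
  set K := (c / b) / (2 * b * M) ^ r with hK
  have hKpos : 0 < K := by positivity
  have hdiff : ∀ t > 0, v' t ≤ -K * (v t) ^ (1 + r) := by
    intro t ht
    have hwin : ∀ s ∈ Icc (t - h) t, ‖y s‖ ≤ δ := fun s hs => hinv s (by linarith [hs.1])
    have q1 := hder t ht hwin
    have hgc : Continuous fun s => ‖y s‖ ^ γ := hy.norm.rpow_const fun s => Or.inr hγ0.le
    have hpc : Continuous fun s => ‖y s‖ ^ p := hy.norm.rpow_const fun s => Or.inr hp0.le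
    have q2 := lk_power (fun s => ‖y s‖ ^ γ) hgc (fun s => rpow_nonneg (norm_nonneg _) _)
      (‖y t‖ ^ γ) h t (1 + r) hh (rpow_nonneg (norm_nonneg _) _) (by linarith)
    simp only [← rpow_mul (norm_nonneg _), hγr, add_sub_cancel_left] at q2
    set I := ∫ s in (t-h)..t, ‖y s‖ ^ γ with hI
    set R := ∫ s in (t-h)..t, ‖y s‖ ^ p with hR
    have hI0 : 0 ≤ I :=
      intervalIntegral.integral_nonneg (by linarith) fun s _ => rpow_nonneg (norm_nonneg _) _
    have q3 : R ≤ d * I := by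
      rw [hI, ← intervalIntegral.integral_const_mul]
      exact intervalIntegral.integral_mono_on (by linarith) (hpc.intervalIntegrable _ _)
        ((hgc.const_mul d).intervalIntegrable _ _)
        fun s hs => hpδ _ (norm_nonneg _) (hwin s hs)
    have q4 : v t ≤ b * (‖y t‖ ^ γ + I) := by
      have u1 := hvup t
      have u2 := mul_le_mul_of_nonneg_left (hpδ _ (norm_nonneg _) (hinv0 t ht.le).le)
        (by positivity : 0 ≤ 2 * h * m * k₂)
      have u3 := mul_le_mul_of_nonneg_left q3 (by positivity : 0 ≤ m * k₂ + w₁ + h * w₂)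
      have u4 := mul_le_mul_of_nonneg_right hb_1 (rpow_nonneg (norm_nonneg (y t)) γ)
      have u5 := mul_le_mul_of_nonneg_right hb_2 hI0
      linarith
    have q5 : (v t) ^ (1 + r) ≤ b ^ (1 + r) * ((2 * M) ^ r * (‖y t‖ ^ p + R)) := by
      refine (rpow_le_rpow (hvnn t ht.le) q4 (by linarith)).trans ?_
      rw [mul_rpow hbpos.le (by positivity)]
      exact mul_le_mul_of_nonneg_left q2 (by positivity)
    have q6 : K * (b ^ (1 + r) * ((2 * M) ^ r * (‖y t‖ ^ p + R))) = c * (‖y t‖ ^ p + R) := by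
      have e1 : (2 * b * M) ^ r = b ^ r * (2 * M) ^ r := by
        rw [← mul_rpow hbpos.le (by positivity)]; congr 1; ring
      have e2 : b ^ (1 + r) = b * b ^ r := by rw [rpow_add hbpos, rpow_one]
      have : 0 < b ^ r := rpow_pos_of_pos hbpos _
      have : 0 < (2 * M) ^ r := by positivity
      rw [hK, e1, e2]
      field_simp
    have q7 := mul_le_mul_of_nonneg_left q5 hKpos.le
    linarith
  intro t ht
  rw [← hyx t (by linarith)]
  have hlt := hlow t (hinv0 t ht).le
  set Q := k₁ + β * Δ ^ (μ - 1) with hQ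
  have hQpos : 0 < Q := by positivity
  rcases hN0.eq_or_lt with hNz | hNpos
  · rw [← hNz]
    rw [← hNz, zero_rpow hγ0.ne', zero_rpow hp0.ne'] at hv0N
    have q1 := hdecr t ht fun s hs => (hinv0 s hs.1).le
    have q2 : ‖y t‖ = 0 := by
      by_contra hne
      have : 0 < ‖y t‖ := lt_of_le_of_ne (norm_nonneg _) (Ne.symm hne)
      have : 0 < a₁ * ‖y t‖ ^ γ := by positivity
      linarith
    rw [q2]
    simp
  · set A := Q * N ^ γ with hA
    have hApos : 0 < A := by positivity
    have hv0A : v 0 ≤ A := by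
      refine hv0N.trans ?_
      rw [hpsplit N hN0, hA, hQ, add_mul]
      have q1 : N ^ (μ - 1) ≤ Δ ^ (μ - 1) := rpow_le_rpow hN0 hφΔ.le hμ1.le
      have q2 : β * (N ^ (μ - 1) * N ^ γ) ≤ β * (Δ ^ (μ - 1) * N ^ γ) := by gcongr
      linarith
    have hfin := lk_compare v v' r K A hr0 hKpos.le hApos hvc.continuousOn hvd hvnn hdiff hv0A t ht
    have hγr' : γ * r = μ - 1 := by rw [hr]; field_simp
    have hAr : r * K * A ^ r = c₂ * N ^ (μ - 1) := by
      rw [hc₂, hA, mul_rpow hQpos.le (by positivity), ← rpow_mul hN0, hγr',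
        div_rpow hQpos.le (by positivity), hK]
      ring
    rw [hAr] at hfin
    set X := 1 + c₂ * N ^ (μ - 1) * t with hX
    have hXpos : 0 < X := by
      rw [hX, ← hAr]; positivity
    have hle : ‖y t‖ ^ γ ≤ Q / a₁ * N ^ γ * X ^ (-(1 / r)) := by
      have : ‖y t‖ ^ γ ≤ (A * X ^ (-(1 / r))) / a₁ := by
        rw [le_div_iff₀ ha₁pos]; linarith
      refine this.trans (le_of_eq ?_)
      rw [hA]; ring
    have hle2 := rpow_le_rpow (by positivity) hle (by positivity : 0 ≤ 1 / γ)
    rw [← rpow_mul (norm_nonneg _), mul_one_div_cancel hγ0.ne', rpow_one,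
      mul_rpow (by positivity) (by positivity), mul_rpow (by positivity) (by positivity),
      ← rpow_mul hN0, mul_one_div_cancel hγ0.ne', rpow_one, ← rpow_mul hXpos.le, ← hc₁] at hle2
    have e : -(1 / r) * (1 / γ) = -(1 / (μ - 1)) := by
      rw [← hγr']; field_simp
    rwa [e] at hle2
end

section
/- Let χ > 0 be such that a₂ := w₁ − k₂ m χ^{2(γ−1)} > 0, let L = m m₁ k₂ + m² k₃, H₁ = (k₀/(h k₂ m (1 + χ^{−2μ})))^{1/(μ−1)}, H₂ = (min{w₀/(4hL), w₁/(2hL), w₂/(2L)})^{1/(μ−1)}, and let δ ∈ (0, min{H₁, H₂}). Set b = max{k₁ + 2 h m k₂ δ^{μ−1}, (m k₂ + w₁ + h w₂)δ^{μ−1}}, c = min{w₀ − 4hLδ^{μ−1}, w₂ − 2Lδ^{μ−1}}, L₁ = (2·max{1,h})^{(μ−1)/γ}, and L₂ = c/(b^{(γ+μ−1)/γ}·L₁). Let x be a solution of the delay system and t > 0 be such that ‖x(t+θ)‖ ≤ δ for all θ ∈ [−h,0]. Then v_x is differentiable at t with v_x′(t) ≤ −L₂·(v_x(t))^{(γ+μ−1)/γ}.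 -/
open Real Set RealInnerProductSpace

theorem aux_param_deriv {E : Type*} [NormedAddCommGroup E] [NormedSpace ℝ E]
    [FiniteDimensional ℝ E] (f : E × E → E) (hf : ContDiff ℝ 1 f)
    (y : ℝ → E) (hy : Continuous y) (z₀ : E) (a b : ℝ) :
    HasFDerivAt (fun z => ∫ s in a..b, f (z, y s))
      (∫ s in a..b, (fderiv ℝ f (z₀, y s)).comp (ContinuousLinearMap.inl ℝ E E)) z₀ := by
  have : ProperSpace E := FiniteDimensional.proper ℝ E
  have hfc : Continuous f := hf.continuous
  have hdc : Continuous (fderiv ℝ f) := hf.continuous_fderiv one_ne_zero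
  have hK : IsCompact (Metric.closedBall z₀ 1 ×ˢ (y '' uIcc a b)) :=
    (isCompact_closedBall z₀ 1).prod (isCompact_uIcc.image hy)
  have hcc : Continuous (fun p : E × E => (fderiv ℝ f p).comp (ContinuousLinearMap.inl ℝ E E)) := by
    fun_prop
  obtain ⟨C, hC⟩ := hK.exists_bound_of_continuousOn hcc.continuousOn
  refine intervalIntegral.hasFDerivAt_integral_of_dominated_of_fderiv_le
    (F := fun z s => f (z, y s))
    (F' := fun z s => (fderiv ℝ f (z, y s)).comp (ContinuousLinearMap.inl ℝ E E))
    (s := Metric.closedBall z₀ 1) (bound := fun _ => C)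
    (Metric.closedBall_mem_nhds z₀ one_pos) ?_ ?_ ?_ ?_ ?_ ?_
  · exact Filter.Eventually.of_forall fun z =>
      (hfc.comp (by fun_prop : Continuous fun s => (z, y s))).aestronglyMeasurable
  · exact (hfc.comp (by fun_prop : Continuous fun s => (z₀, y s))).intervalIntegrable _ _
  · exact (hcc.comp (by fun_prop : Continuous fun s => (z₀, y s))).aestronglyMeasurable
  · refine Filter.Eventually.of_forall fun s hs z hz => hC (z, y s) ⟨hz, ?_⟩
    exact ⟨s, uIoc_subset_uIcc hs, rfl⟩
  · exact intervalIntegrable_const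
  · refine Filter.Eventually.of_forall fun s hs z hz => ?_
    have h1 : HasFDerivAt f (fderiv ℝ f (z, y s)) (z, y s) :=
      (hf.differentiable one_ne_zero _).hasFDerivAt
    exact h1.comp z (hasFDerivAt_prodMk_left z (y s))

theorem aux_strict {E : Type*} [NormedAddCommGroup E] [NormedSpace ℝ E]
    [FiniteDimensional ℝ E] (f : E × E → E) (hf : ContDiff ℝ 1 f)
    (y : ℝ → E) (hy : Continuous y) (z₀ : E) (b : ℝ) :
    HasFDerivAt (fun p : E × ℝ => ∫ s in (0:ℝ)..p.2, f (p.1, y s))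
      ((∫ s in (0:ℝ)..b, (fderiv ℝ f (z₀, y s)).comp (ContinuousLinearMap.inl ℝ E E)).coprod
        (ContinuousLinearMap.toSpanSingleton ℝ (f (z₀, y b)))) (z₀, b) := by
  have : CompleteSpace E := FiniteDimensional.complete ℝ E
  have hfc : Continuous f := hf.continuous
  have hdc : Continuous (fderiv ℝ f) := hf.continuous_fderiv one_ne_zero
  have hcc : Continuous (fun p : E × E => (fderiv ℝ f p).comp (ContinuousLinearMap.inl ℝ E E)) := by
    fun_prop
  refine (hasStrictFDerivAt_uncurry_coprod (𝕜 := ℝ) (u := (z₀, b))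
    (f := fun (z : E) (τ : ℝ) => ∫ s in (0:ℝ)..τ, f (z, y s))
    (f₁ := fun z τ => ∫ s in (0:ℝ)..τ,
      (fderiv ℝ f (z, y s)).comp (ContinuousLinearMap.inl ℝ E E))
    (f₂ := fun z τ => ContinuousLinearMap.toSpanSingleton ℝ (f (z, y τ))) ?_ ?_ ?_ ?_).hasFDerivAt
  · exact Filter.Eventually.of_forall fun v => aux_param_deriv f hf y hy v.1 0 v.2
  · refine Filter.Eventually.of_forall fun v => ?_
    have hc : Continuous fun s => f (v.1, y s) := hfc.comp (by fun_prop)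
    exact (intervalIntegral.integral_hasDerivAt_right (hc.intervalIntegrable _ _)
      (hc.stronglyMeasurableAtFilter _ _) hc.continuousAt).hasFDerivAt
  · refine Continuous.continuousAt ?_
    exact intervalIntegral.continuous_parametric_primitive_of_continuous
      (f := fun z s => (fderiv ℝ f (z, y s)).comp (ContinuousLinearMap.inl ℝ E E))
      (hcc.comp (by fun_prop : Continuous fun p : E × ℝ => (p.1, y p.2)))
  · refine Continuous.continuousAt ?_
    have h1 : Continuous fun p : E × ℝ => f (p.1, y p.2) := hfc.comp (by fun_prop)
    exact (ContinuousLinearMap.toSpanSingletonCLE (𝕜 := ℝ) (E := E)).continuous.comp h1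

theorem aux_I_deriv {E : Type*} [NormedAddCommGroup E] [NormedSpace ℝ E]
    [FiniteDimensional ℝ E] (f : E × E → E) (hf : ContDiff ℝ 1 f)
    (y : ℝ → E) (hy : Continuous y) (t h : ℝ) (F : E) (hd : HasDerivAt y F t) :
    HasDerivAt (fun τ => ∫ s in (τ - h)..τ, f (y τ, y s))
      ((∫ s in (t - h)..t, fderiv ℝ (fun x' => f (x', y s)) (y t) F)
        + f (y t, y t) - f (y t, y (t - h))) t := by
  have : CompleteSpace E := FiniteDimensional.complete ℝ E
  have hfc : Continuous f := hf.continuous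
  have hdc : Continuous (fderiv ℝ f) := hf.continuous_fderiv one_ne_zero
  have hcc : Continuous (fun p : E × E => (fderiv ℝ f p).comp (ContinuousLinearMap.inl ℝ E E)) := by
    fun_prop
  have hcs : Continuous (fun s => (fderiv ℝ f (y t, y s)).comp (ContinuousLinearMap.inl ℝ E E)) :=
    hcc.comp (by fun_prop : Continuous fun s => (y t, y s))
  have h1 := HasFDerivAt.comp_hasDerivAt (f := fun τ => (y τ, id τ)) t
    (aux_strict f hf y hy (y t) t) (hd.prodMk (hasDerivAt_id t))
  have h2 := HasFDerivAt.comp_hasDerivAt (f := fun τ => (y τ, id τ - h)) t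
    (aux_strict f hf y hy (y t) (t - h))
    (hd.prodMk ((hasDerivAt_id t).sub_const h))
  have h3 := h1.sub h2
  refine (h3.congr_of_eventuallyEq ?_).congr_deriv ?_
  · refine Filter.Eventually.of_forall fun τ => ?_
    have hc : Continuous fun s => f (y τ, y s) := hfc.comp (by fun_prop)
    simp only [Function.comp, Pi.sub_apply, id]
    rw [intervalIntegral.integral_interval_sub_left] <;> exact hc.intervalIntegrable _ _
  · have e : ∀ s, fderiv ℝ (fun x' => f (x', y s)) (y t) F
        = ((fderiv ℝ f (y t, y s)).comp (ContinuousLinearMap.inl ℝ E E)) F := by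
      intro s
      have h1 : HasFDerivAt f (fderiv ℝ f (y t, y s)) (y t, y s) :=
        (hf.differentiable one_ne_zero _).hasFDerivAt
      have h2 : HasFDerivAt (fun x' => f (x', y s))
          ((fderiv ℝ f (y t, y s)).comp (ContinuousLinearMap.inl ℝ E E)) (y t) :=
        h1.comp (y t) (hasFDerivAt_prodMk_left (y t) (y s))
      rw [h2.fderiv]
    simp_rw [e]
    rw [← ContinuousLinearMap.intervalIntegral_apply (hcs.intervalIntegrable _ _),
      ← intervalIntegral.integral_interval_sub_left (hcs.intervalIntegrable 0 t)
        (hcs.intervalIntegrable 0 (t - h))]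
    simp only [ContinuousLinearMap.coprod_apply, ContinuousLinearMap.toSpanSingleton_apply,
      one_smul, sub_apply]
    abel

theorem aux_J_deriv (g : ℝ → ℝ) (hg : Continuous g) (w₁ w₂ h t : ℝ) :
    HasDerivAt (fun τ => ∫ s in (τ - h)..τ, (w₁ + (h + s - τ) * w₂) * g s)
      ((w₁ + h * w₂) * g t - w₁ * g (t - h) - w₂ * ∫ s in (t - h)..t, g s) t := by
  have key : ∀ k : ℝ → ℝ, Continuous k →
      HasDerivAt (fun τ => ∫ s in (τ - h)..τ, k s) (k t - k (t - h)) t := by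
    intro k hk
    have h1 : ∀ b, HasDerivAt (fun τ => ∫ s in (0:ℝ)..τ, k s) (k b) b := fun b =>
      intervalIntegral.integral_hasDerivAt_right (hk.intervalIntegrable _ _)
        (hk.stronglyMeasurableAtFilter _ _) hk.continuousAt
    have h2 := (h1 t).sub ((h1 (t - h)).comp t ((hasDerivAt_id t).sub_const h))
    refine (h2.congr_of_eventuallyEq ?_).congr_deriv (by simp)
    refine Filter.Eventually.of_forall fun τ => ?_
    simp only [Function.comp, Pi.sub_apply, id]
    rw [intervalIntegral.integral_interval_sub_left] <;> exact hk.intervalIntegrable _ _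
  have hsg : Continuous fun s => s * g s := by fun_prop
  have hA : HasDerivAt (fun τ : ℝ => w₁ + (h - τ) * w₂) (-w₂) t := by
    have := (((hasDerivAt_id t).const_sub h).mul_const w₂).const_add w₁
    simpa using this
  have h2 := (hA.mul (key g hg)).add ((key _ hsg).const_mul w₂)
  refine (h2.congr_of_eventuallyEq ?_).congr_deriv ?_
  · refine Filter.Eventually.of_forall fun τ => ?_
    simp only [Pi.add_apply, Pi.mul_apply]
    rw [← intervalIntegral.integral_const_mul, ← intervalIntegral.integral_const_mul,
      ← intervalIntegral.integral_add]
    · refine intervalIntegral.integral_congr fun s _ => ?_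
      ring
    · exact Continuous.intervalIntegrable (by fun_prop) _ _
    · exact Continuous.intervalIntegrable (by fun_prop) _ _
  · ring

theorem aux_mono3 {x y z M α β κ : ℝ} (hx : 0 ≤ x) (hy : 0 ≤ y) (hz : 0 ≤ z)
    (hxM : x ≤ M) (hyM : y ≤ M) (hzM : z ≤ M) (hα : 0 ≤ α) (hβ : 0 ≤ β) (hκ : 0 ≤ κ) :
    x ^ α * y ^ β * z ^ κ ≤ M ^ (α + β + κ) := by
  have hM : 0 ≤ M := hx.trans hxM
  rw [rpow_add_of_nonneg hM (by positivity) hκ, rpow_add_of_nonneg hM hα hβ]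
  gcongr

theorem aux_mono3' {x y z M δ α β κ p e : ℝ} (hx : 0 ≤ x) (hy : 0 ≤ y) (hz : 0 ≤ z)
    (hxM : x ≤ M) (hyM : y ≤ M) (hzM : z ≤ M) (hMδ : M ≤ δ)
    (hα : 0 ≤ α) (hβ : 0 ≤ β) (hκ : 0 ≤ κ)
    (he : 0 ≤ e) (hp : 0 ≤ p) (hs : α + β + κ = e + p) :
    x ^ α * y ^ β * z ^ κ ≤ δ ^ e * M ^ p := by
  have hM : 0 ≤ M := hx.trans hxM
  refine (aux_mono3 hx hy hz hxM hyM hzM hα hβ hκ).trans ?_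
  rw [hs, rpow_add_of_nonneg hM he hp]
  gcongr

theorem aux_max_rpow {a d p : ℝ} (ha : 0 ≤ a) (hd : 0 ≤ d) :
    (max a d) ^ p ≤ a ^ p + d ^ p := by
  have := rpow_nonneg ha p
  have := rpow_nonneg hd p
  rcases max_choice a d with h | h <;> rw [h] <;> linarith

theorem aux_b1 {a d r δ γ μ : ℝ} (hγ : 2 ≤ γ) (hμ : 1 < μ) (ha : 0 ≤ a) (hd : 0 ≤ d) (hr : 0 ≤ r)
    (haδ : a ≤ δ) (hdδ : d ≤ δ) (hrδ : r ≤ δ) :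
    a ^ (γ - 2) * (a ^ μ + d ^ μ) * (a ^ μ + r ^ μ) ≤
      δ ^ (μ - 1) * (4 * a ^ (γ + μ - 1) + 2 * d ^ (γ + μ - 1) + 2 * r ^ (γ + μ - 1)) := by
  have hδ : 0 ≤ δ ^ (μ - 1) := rpow_nonneg (ha.trans haδ) _
  have t1 : a ^ (γ - 2) * a ^ μ * a ^ μ ≤ δ ^ (μ - 1) * a ^ (γ + μ - 1) :=
    aux_mono3' ha ha ha le_rfl le_rfl le_rfl haδ (by linarith) (by linarith) (by linarith)
      (by linarith) (by linarith) (by ring)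
  have t2 : a ^ (γ - 2) * d ^ μ * a ^ μ ≤ δ ^ (μ - 1) * (max a d) ^ (γ + μ - 1) :=
    aux_mono3' ha hd ha (le_max_left _ _) (le_max_right _ _) (le_max_left _ _) (max_le haδ hdδ)
      (by linarith) (by linarith) (by linarith) (by linarith) (by linarith) (by ring)
  have t3 : a ^ (γ - 2) * a ^ μ * r ^ μ ≤ δ ^ (μ - 1) * (max a r) ^ (γ + μ - 1) :=
    aux_mono3' ha ha hr (le_max_left _ _) (le_max_left _ _) (le_max_right _ _) (max_le haδ hrδ)
      (by linarith) (by linarith) (by linarith) (by linarith) (by linarith) (by ring)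
  have t4 : a ^ (γ - 2) * d ^ μ * r ^ μ ≤ δ ^ (μ - 1) * (max a (max d r)) ^ (γ + μ - 1) :=
    aux_mono3' ha hd hr (le_max_left _ _) ((le_max_left _ _).trans (le_max_right _ _))
      ((le_max_right _ _).trans (le_max_right _ _)) (max_le haδ (max_le hdδ hrδ))
      (by linarith) (by linarith) (by linarith) (by linarith) (by linarith) (by ring)
  have m2 := mul_le_mul_of_nonneg_left (aux_max_rpow (p := γ + μ - 1) ha hd) hδ
  have m3 := mul_le_mul_of_nonneg_left (aux_max_rpow (p := γ + μ - 1) ha hr) hδ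
  have m4 := mul_le_mul_of_nonneg_left ((aux_max_rpow (p := γ + μ - 1) ha
    (hd.trans (le_max_left d r))).trans
      (add_le_add_right (aux_max_rpow (p := γ + μ - 1) hd hr) _)) hδ
  linarith

theorem aux_b2 {a d r δ γ μ : ℝ} (hγ : 2 ≤ γ) (hμ : 1 < μ) (ha : 0 ≤ a) (hd : 0 ≤ d) (hr : 0 ≤ r)
    (haδ : a ≤ δ) (hdδ : d ≤ δ) (hrδ : r ≤ δ) :
    a ^ (γ - 1) * (a ^ μ + d ^ μ) * (a ^ (μ - 1) + r ^ (μ - 1)) ≤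
      δ ^ (μ - 1) * (4 * a ^ (γ + μ - 1) + 2 * d ^ (γ + μ - 1) + 2 * r ^ (γ + μ - 1)) := by
  have hδ : 0 ≤ δ ^ (μ - 1) := rpow_nonneg (ha.trans haδ) _
  have t1 : a ^ (γ - 1) * a ^ μ * a ^ (μ - 1) ≤ δ ^ (μ - 1) * a ^ (γ + μ - 1) :=
    aux_mono3' ha ha ha le_rfl le_rfl le_rfl haδ (by linarith) (by linarith) (by linarith)
      (by linarith) (by linarith) (by ring)
  have t2 : a ^ (γ - 1) * d ^ μ * a ^ (μ - 1) ≤ δ ^ (μ - 1) * (max a d) ^ (γ + μ - 1) :=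
    aux_mono3' ha hd ha (le_max_left _ _) (le_max_right _ _) (le_max_left _ _) (max_le haδ hdδ)
      (by linarith) (by linarith) (by linarith) (by linarith) (by linarith) (by ring)
  have t3 : a ^ (γ - 1) * a ^ μ * r ^ (μ - 1) ≤ δ ^ (μ - 1) * (max a r) ^ (γ + μ - 1) :=
    aux_mono3' ha ha hr (le_max_left _ _) (le_max_left _ _) (le_max_right _ _) (max_le haδ hrδ)
      (by linarith) (by linarith) (by linarith) (by linarith) (by linarith) (by ring)
  have t4 : a ^ (γ - 1) * d ^ μ * r ^ (μ - 1) ≤ δ ^ (μ - 1) * (max a (max d r)) ^ (γ + μ - 1) :=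
    aux_mono3' ha hd hr (le_max_left _ _) ((le_max_left _ _).trans (le_max_right _ _))
      ((le_max_right _ _).trans (le_max_right _ _)) (max_le haδ (max_le hdδ hrδ))
      (by linarith) (by linarith) (by linarith) (by linarith) (by linarith) (by ring)
  have m2 := mul_le_mul_of_nonneg_left (aux_max_rpow (p := γ + μ - 1) ha hd) hδ
  have m3 := mul_le_mul_of_nonneg_left (aux_max_rpow (p := γ + μ - 1) ha hr) hδ
  have m4 := mul_le_mul_of_nonneg_left ((aux_max_rpow (p := γ + μ - 1) ha
    (hd.trans (le_max_left d r))).trans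
      (add_le_add_right (aux_max_rpow (p := γ + μ - 1) hd hr) _)) hδ
  linarith

/-- `a^{γ-1}(a^μ + r^μ) ≤ δ^{μ-1}(2 a^γ + r^γ)`. -/
theorem aux_b3 {a r δ γ μ : ℝ} (hγ : 2 ≤ γ) (hμ : 1 < μ) (ha : 0 ≤ a) (hr : 0 ≤ r)
    (haδ : a ≤ δ) (hrδ : r ≤ δ) :
    a ^ (γ - 1) * (a ^ μ + r ^ μ) ≤ δ ^ (μ - 1) * (2 * a ^ γ + r ^ γ) := by
  have hδ : 0 ≤ δ ^ (μ - 1) := rpow_nonneg (ha.trans haδ) _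
  have t1 : a ^ (γ - 1) * a ^ μ * a ^ (0:ℝ) ≤ δ ^ (μ - 1) * a ^ γ :=
    aux_mono3' ha ha ha le_rfl le_rfl le_rfl haδ (by linarith) (by linarith) (by linarith)
      (by linarith) (by linarith) (by ring)
  have t3 : a ^ (γ - 1) * r ^ μ * a ^ (0:ℝ) ≤ δ ^ (μ - 1) * (max a r) ^ γ :=
    aux_mono3' ha hr ha (le_max_left _ _) (le_max_right _ _) (le_max_left _ _) (max_le haδ hrδ)
      (by linarith) (by linarith) (by linarith) (by linarith) (by linarith) (by ring)
  have m3 := mul_le_mul_of_nonneg_left (aux_max_rpow (p := γ) ha hr) hδ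
  rw [rpow_zero] at t1 t3
  linarith

theorem aux_pd {r δ γ μ : ℝ} (hγ : 2 ≤ γ) (hμ : 1 < μ) (hr : 0 ≤ r) (hrδ : r ≤ δ) :
    r ^ (γ + μ - 1) ≤ δ ^ (μ - 1) * r ^ γ := by
  have e : γ + μ - 1 = (μ - 1) + γ := by ring
  rw [e, rpow_add_of_nonneg hr (by linarith) (by linarith)]
  gcongr

theorem aux_young {a r χ δ γ μ : ℝ} (hγ : 2 ≤ γ) (hμ : 1 < μ) (hχ : 0 < χ) (ha : 0 ≤ a)
    (hr : 0 ≤ r) (haδ : a ≤ δ) :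
    a ^ (γ - 1) * (a ^ μ + r ^ μ) ≤ (1 + χ ^ (-(2 * μ))) * δ ^ (μ - 1) * a ^ γ
      + χ ^ (2 * (γ - 1)) * r ^ (γ + μ - 1) := by
  have hc1 : 0 < χ ^ (-(2 * μ)) := rpow_pos_of_pos hχ _
  have hc2 : 0 < χ ^ (2 * (γ - 1)) := rpow_pos_of_pos hχ _
  have h1 := aux_pd hγ hμ ha haδ
  have e : γ + μ - 1 = (γ - 1) + μ := by ring
  have ea : a ^ (γ + μ - 1) = a ^ (γ - 1) * a ^ μ := by
    rw [e, rpow_add_of_nonneg ha (by linarith) (by linarith)]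
  have er : r ^ (γ + μ - 1) = r ^ (γ - 1) * r ^ μ := by
    rw [e, rpow_add_of_nonneg hr (by linarith) (by linarith)]
  have hap : 0 ≤ a ^ (γ + μ - 1) := rpow_nonneg ha _
  have hrp : 0 ≤ r ^ (γ + μ - 1) := rpow_nonneg hr _
  have key : a ^ (γ - 1) * r ^ μ ≤ χ ^ (-(2 * μ)) * a ^ (γ + μ - 1)
      + χ ^ (2 * (γ - 1)) * r ^ (γ + μ - 1) := by
    have hχ2 : 0 < χ ^ (2:ℝ) := rpow_pos_of_pos hχ _
    rcases le_total a (χ ^ (2:ℝ) * r) with hle | hle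
    · have : a ^ (γ - 1) ≤ χ ^ (2 * (γ - 1)) * r ^ (γ - 1) := by
        rw [rpow_mul hχ.le, ← mul_rpow hχ2.le hr]
        exact rpow_le_rpow ha hle (by linarith)
      have h3 := mul_le_mul_of_nonneg_right this (rpow_nonneg hr μ)
      rw [er]
      have : 0 ≤ χ ^ (-(2 * μ)) * a ^ (γ + μ - 1) := by positivity
      linarith
    · have : r ^ μ ≤ χ ^ (-(2 * μ)) * a ^ μ := by
        have e2 : χ ^ (-(2 * μ)) = ((χ ^ (2:ℝ))⁻¹) ^ μ := by
          rw [inv_rpow hχ2.le, ← rpow_mul hχ.le, rpow_neg hχ.le]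
        rw [e2, ← mul_rpow (by positivity) ha]
        refine rpow_le_rpow hr ?_ (by linarith)
        rw [inv_mul_eq_div, le_div_iff₀ hχ2]
        linarith
      have h3 := mul_le_mul_of_nonneg_left this (rpow_nonneg ha (γ - 1))
      rw [ea]
      have : 0 ≤ χ ^ (2 * (γ - 1)) * r ^ (γ + μ - 1) := by positivity
      linarith
  have h4 := mul_le_mul_of_nonneg_left h1 hc1.le
  linarith

theorem aux_inner_int {E : Type*} [NormedAddCommGroup E] [InnerProductSpace ℝ E]
    [CompleteSpace E] (u : E) (φ : ℝ → E) (hφ : Continuous φ) (g : ℝ → ℝ) (hg : Continuous g)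
    {a b : ℝ} (hab : a ≤ b) (hb : ∀ s ∈ Icc a b, ‖u‖ * ‖φ s‖ ≤ g s) :
    |⟪u, ∫ s in a..b, φ s⟫| ≤ ∫ s in a..b, g s := by
  calc |⟪u, ∫ s in a..b, φ s⟫| ≤ ‖u‖ * ‖∫ s in a..b, φ s‖ := abs_real_inner_le_norm _ _
    _ ≤ ‖u‖ * ∫ s in a..b, ‖φ s‖ := by
      gcongr
      exact intervalIntegral.norm_integral_le_integral_norm hab
    _ = ∫ s in a..b, ‖u‖ * ‖φ s‖ := by rw [intervalIntegral.integral_const_mul]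
    _ ≤ ∫ s in a..b, g s := by
      refine intervalIntegral.integral_mono_on hab ?_ (hg.intervalIntegrable _ _) hb
      exact Continuous.intervalIntegrable (by fun_prop) _ _

theorem aux_jensen (g : ℝ → ℝ) (hg : Continuous g) (hg0 : ∀ s, 0 ≤ g s) {a h q : ℝ}
    (hh : 0 < h) (hq : 1 ≤ q) :
    (∫ s in (a - h)..a, g s) ^ q ≤ h ^ (q - 1) * ∫ s in (a - h)..a, (g s) ^ q := by
  have hle : a - h ≤ a := by linarith
  have hvol : MeasureTheory.volume.real (Ioc (a - h) a) = h := by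
    simp [MeasureTheory.Measure.real, hh.le]
  have hgq : Continuous fun s => g s ^ q := hg.rpow_const fun _ => Or.inr (by linarith)
  have : NeZero (MeasureTheory.volume.restrict (Ioc (a - h) a)) := by
    refine ⟨fun h0 => ?_⟩
    rw [MeasureTheory.Measure.restrict_eq_zero] at h0
    simp at h0; linarith
  have hJ := (convexOn_rpow hq).map_average_le (f := g)
    (μ := MeasureTheory.volume.restrict (Ioc (a - h) a))
    (continuousOn_id.rpow_const fun _ _ => Or.inr (by linarith)) isClosed_Ici
    (Filter.Eventually.of_forall fun s => hg0 s)
    (hg.integrableOn_Ioc) (hgq.integrableOn_Ioc)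
  rw [MeasureTheory.setAverage_eq, MeasureTheory.setAverage_eq, hvol,
    ← intervalIntegral.integral_of_le hle, ← intervalIntegral.integral_of_le hle] at hJ
  have hI : 0 ≤ ∫ s in (a - h)..a, g s :=
    intervalIntegral.integral_nonneg hle fun s _ => hg0 s
  simp only [smul_eq_mul] at hJ
  rw [mul_rpow (by positivity) hI, inv_rpow hh.le] at hJ
  have hhq : 0 < h ^ q := rpow_pos_of_pos hh _
  rw [rpow_sub_one hh.ne']
  calc _ = h ^ q * ((h ^ q)⁻¹ * (∫ s in (a - h)..a, g s) ^ q) := by field_simp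
    _ ≤ h ^ q * (h⁻¹ * ∫ s in (a - h)..a, (g s) ^ q) := by gcongr
    _ = _ := by ring

theorem aux_two {A B q : ℝ} (hA : 0 ≤ A) (hB : 0 ≤ B) (hq : 1 ≤ q) :
    (A + B) ^ q ≤ 2 ^ (q - 1) * (A ^ q + B ^ q) := by
  have := NNReal.rpow_add_le_mul_rpow_add_rpow ⟨A, hA⟩ ⟨B, hB⟩ hq
  exact_mod_cast this

theorem aux_power {A Q P h q : ℝ} (hA : 0 ≤ A) (hQ : 0 ≤ Q) (hP : 0 ≤ P) (hh : 0 < h)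
    (hq : 1 ≤ q) (hQP : Q ^ q ≤ h ^ (q - 1) * P) :
    (A + Q) ^ q ≤ (2 * max 1 h) ^ (q - 1) * (A ^ q + P) := by
  refine (aux_two hA hQ hq).trans ?_
  rw [mul_rpow (by norm_num) (by positivity), mul_assoc]
  have h1 : 1 ≤ (max 1 h) ^ (q - 1) := one_le_rpow (le_max_left _ _) (by linarith)
  have h2 : h ^ (q - 1) ≤ (max 1 h) ^ (q - 1) :=
    rpow_le_rpow hh.le (le_max_right _ _) (by linarith)
  have hAq : 0 ≤ A ^ q := rpow_nonneg hA _
  gcongr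
  nlinarith [mul_le_mul_of_nonneg_right h2 hP]

theorem aux_core
    {n : ℕ}
    (h μ : ℝ) (hh : 0 < h) (hμ : 1 < μ)
    (f : EuclideanSpace ℝ (Fin n) × EuclideanSpace ℝ (Fin n) → EuclideanSpace ℝ (Fin n))
    (hf : ContDiff ℝ 1 f)
    (m m₁ : ℝ) (hm : 0 < m) (hm₁ : 0 < m₁)
    (hfb : ∀ x y : EuclideanSpace ℝ (Fin n), ‖f (x, y)‖ ≤ m * (‖x‖ ^ μ + ‖y‖ ^ μ))
    (hfx : ∀ x y : EuclideanSpace ℝ (Fin n),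
      ‖fderiv ℝ (fun x' => f (x', y)) x‖ ≤ m₁ * (‖x‖ ^ (μ - 1) + ‖y‖ ^ (μ - 1)))
    (γ : ℝ) (hγ : 2 ≤ γ)
    (V : EuclideanSpace ℝ (Fin n) → ℝ) (hV : ContDiff ℝ 2 V)
    (k₀ k₁ k₂ k₃ w : ℝ) (hk₀ : 0 < k₀) (hk₁ : 0 < k₁) (hk₂ : 0 < k₂) (hk₃ : 0 < k₃)
    (hw : 0 < w)
    (hVlb : ∀ x : EuclideanSpace ℝ (Fin n), k₀ * ‖x‖ ^ γ ≤ V x)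
    (hVub : ∀ x : EuclideanSpace ℝ (Fin n), V x ≤ k₁ * ‖x‖ ^ γ)
    (hgrad : ∀ x : EuclideanSpace ℝ (Fin n), ‖gradient V x‖ ≤ k₂ * ‖x‖ ^ (γ - 1))
    (hhess : ∀ x : EuclideanSpace ℝ (Fin n),
      ‖fderiv ℝ (gradient V) x‖ ≤ k₃ * ‖x‖ ^ (γ - 2))
    (hdV : ∀ x : EuclideanSpace ℝ (Fin n),
      ⟪gradient V x, f (x, x)⟫ ≤ -w * ‖x‖ ^ (γ + μ - 1))
    (w₀ w₁ w₂ : ℝ) (hw₁ : 0 < w₁) (hw₂ : 0 < w₂)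
    (hw₀ : w₀ = w - w₁ - h * w₂) (hw₀pos : 0 < w₀)
    (χ a₂ L H₁ H₂ δ b c L₁ L₂ : ℝ)
    (hχ : 0 < χ)
    (ha₂ : a₂ = w₁ - k₂ * m * χ ^ (2 * (γ - 1))) (ha₂pos : 0 < a₂)
    (hL : L = m * m₁ * k₂ + m ^ 2 * k₃)
    (hH₁ : H₁ = (k₀ / (h * k₂ * m * (1 + χ ^ (-(2 * μ))))) ^ (1 / (μ - 1)))
    (hH₂ : H₂ = (min (w₀ / (4 * h * L)) (min (w₁ / (2 * h * L)) (w₂ / (2 * L)))) ^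
      (1 / (μ - 1)))
    (hδ : δ ∈ Set.Ioo 0 (min H₁ H₂))
    (hb : b = max (k₁ + 2 * h * m * k₂ * δ ^ (μ - 1)) ((m * k₂ + w₁ + h * w₂) * δ ^ (μ - 1)))
    (hc : c = min (w₀ - 4 * h * L * δ ^ (μ - 1)) (w₂ - 2 * L * δ ^ (μ - 1)))
    (hL₁ : L₁ = (2 * max 1 h) ^ ((μ - 1) / γ))
    (hL₂ : L₂ = c / (b ^ ((γ + μ - 1) / γ) * L₁))
    (x : ℝ → EuclideanSpace ℝ (Fin n))
    (hx : Continuous x) (t : ℝ)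
    (hxd : HasDerivAt x (f (x t, x (t - h))) t)
    (hxδ : ∀ s ∈ Set.Icc (t - h) t, ‖x s‖ ≤ δ) :
    DifferentiableAt ℝ (fun τ => V (x τ) +
        ⟪gradient V (x τ), ∫ s in (τ - h)..τ, f (x τ, x s)⟫ +
        ∫ s in (τ - h)..τ, (w₁ + (h + s - τ) * w₂) * ‖x s‖ ^ (γ + μ - 1)) t ∧
      deriv (fun τ => V (x τ) +
        ⟪gradient V (x τ), ∫ s in (τ - h)..τ, f (x τ, x s)⟫ +
        ∫ s in (τ - h)..τ, (w₁ + (h + s - τ) * w₂) * ‖x s‖ ^ (γ + μ - 1)) t ≤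
      -L₂ * (V (x t) + ⟪gradient V (x t), ∫ s in (t - h)..t, f (x t, x s)⟫ +
        ∫ s in (t - h)..t, (w₁ + (h + s - t) * w₂) * ‖x s‖ ^ (γ + μ - 1)) ^
          ((γ + μ - 1) / γ) := by
  have hfc : Continuous f := hf.continuous
  have hμ1 : 0 < μ - 1 := by linarith
  have hLpos : 0 < L := by rw [hL]; positivity
  obtain ⟨hδ0, hδH⟩ := hδ
  have hd0 : 0 < δ ^ (μ - 1) := rpow_pos_of_pos hδ0 _
  have hroot : ∀ K : ℝ, 0 < K → δ < K ^ (1 / (μ - 1)) → δ ^ (μ - 1) < K := by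
    intro K hK hlt
    have := rpow_lt_rpow hδ0.le hlt hμ1
    rwa [← rpow_mul hK.le, one_div_mul_cancel hμ1.ne', rpow_one] at this
  have hχ1 : 0 < χ ^ (-(2 * μ)) := rpow_pos_of_pos hχ _
  have hd1 : δ ^ (μ - 1) < k₀ / (h * k₂ * m * (1 + χ ^ (-(2 * μ)))) :=
    hroot _ (by positivity) (by rw [← hH₁]; exact hδH.trans_le (min_le_left _ _))
  have hd2 : δ ^ (μ - 1) < min (w₀ / (4 * h * L)) (min (w₁ / (2 * h * L)) (w₂ / (2 * L))) :=
    hroot _ (lt_min (by positivity) (lt_min (by positivity) (by positivity)))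
      (by rw [← hH₂]; exact hδH.trans_le (min_le_right _ _))
  rw [lt_min_iff, lt_min_iff, lt_div_iff₀ (by positivity), lt_div_iff₀ (by positivity),
    lt_div_iff₀ (by positivity)] at hd2
  obtain ⟨hd2a, hd2b, hd2c⟩ := hd2
  rw [lt_div_iff₀ (by positivity)] at hd1
  have hc0 : 0 < c := by
    rw [hc]; exact lt_min (by linarith) (by linarith)
  have hle : t - h ≤ t := by linarith
  have htm : t ∈ Icc (t - h) t := ⟨hle, le_rfl⟩
  have htm' : t - h ∈ Icc (t - h) t := ⟨le_rfl, hle⟩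
  -- derivative of the gradient
  have hgC : ContDiff ℝ 1 (gradient V) := by
    have h1 : ContDiff ℝ 1 (fderiv ℝ V) := hV.fderiv_right (by norm_num)
    exact (InnerProductSpace.toDual ℝ (EuclideanSpace ℝ (Fin n))).symm.contDiff.comp h1
  set X := x t with hX
  set Y := x (t - h) with hY
  have hgd : HasDerivAt (fun τ => gradient V (x τ)) (fderiv ℝ (gradient V) X (f (X, Y))) t :=
    (hgC.differentiable one_ne_zero X).hasFDerivAt.comp_hasDerivAt t hxd
  have hVd : HasDerivAt (fun τ => V (x τ)) ⟪gradient V X, f (X, Y)⟫ t := by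
    have h2 : HasDerivAt (fun τ => V (x τ)) (fderiv ℝ V X (f (X, Y))) t :=
      (hV.differentiable two_ne_zero X).hasFDerivAt.comp_hasDerivAt t hxd
    have h3 : ⟪gradient V X, f (X, Y)⟫ = fderiv ℝ V X (f (X, Y)) :=
      InnerProductSpace.toDual_symm_apply
    rw [h3]
    exact h2
  have hId := aux_I_deriv f hf x hx t h _ hxd
  have hpc : Continuous fun s => ‖x s‖ ^ (γ + μ - 1) :=
    hx.norm.rpow_const fun _ => Or.inr (by linarith)
  have hγc : Continuous fun s => ‖x s‖ ^ γ :=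
    hx.norm.rpow_const fun _ => Or.inr (by linarith)
  have hJd := aux_J_deriv (fun s => ‖x s‖ ^ (γ + μ - 1)) hpc w₁ w₂ h t
  have hvd := (hVd.add (hgd.inner ℝ hId)).add hJd
  simp only [← hX, ← hY] at hvd
  refine ⟨hvd.differentiableAt, ?_⟩
  refine le_trans (le_of_eq hvd.deriv) ?_
  -- abbreviations
  set I := ∫ s in (t - h)..t, f (X, x s) with hI
  set K := ∫ s in (t - h)..t, fderiv ℝ (fun x' => f (x', x s)) X (f (X, Y)) with hK
  set P := ∫ s in (t - h)..t, ‖x s‖ ^ (γ + μ - 1) with hP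
  set Q := ∫ s in (t - h)..t, ‖x s‖ ^ γ with hQ
  set J := ∫ s in (t - h)..t, (w₁ + (h + s - t) * w₂) * ‖x s‖ ^ (γ + μ - 1) with hJ
  have hP0 : 0 ≤ P := intervalIntegral.integral_nonneg hle fun s _ => rpow_nonneg (norm_nonneg _) _
  have hQ0 : 0 ≤ Q := intervalIntegral.integral_nonneg hle fun s _ => rpow_nonneg (norm_nonneg _) _
  have hPi := hpc.intervalIntegrable (μ := MeasureTheory.volume) (t - h) t
  have hQi := hγc.intervalIntegrable (μ := MeasureTheory.volume) (t - h) t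
  have hfi : Continuous fun s => f (X, x s) := hfc.comp (by fun_prop)
  have hXδ : ‖X‖ ≤ δ := hxδ t htm
  have hYδ : ‖Y‖ ≤ δ := hxδ _ htm'
  have hXp : 0 ≤ ‖X‖ ^ (γ + μ - 1) := rpow_nonneg (norm_nonneg _) _
  have hYp : 0 ≤ ‖Y‖ ^ (γ + μ - 1) := rpow_nonneg (norm_nonneg _) _
  have hXγ : 0 ≤ ‖X‖ ^ γ := rpow_nonneg (norm_nonneg _) _
  have hFn := hfb X Y
  -- linear integrals
  have lin : ∀ C A B : ℝ, ∀ g : ℝ → ℝ, Continuous g →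
      ∫ s in (t - h)..t, C * (A + B * g s) = C * (h * A + B * ∫ s in (t - h)..t, g s) := by
    intro C A B g hg
    rw [intervalIntegral.integral_const_mul, intervalIntegral.integral_add
      intervalIntegrable_const ((hg.intervalIntegrable _ _).const_mul _),
      intervalIntegral.integral_const, intervalIntegral.integral_const_mul]
    simp
  -- the two perturbation terms
  have e1 : |⟪fderiv ℝ (gradient V) X (f (X, Y)), I⟫| ≤
      k₃ * m ^ 2 * δ ^ (μ - 1) * (h * (4 * ‖X‖ ^ (γ + μ - 1) + 2 * ‖Y‖ ^ (γ + μ - 1)) + 2 * P) := by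
    rw [hP, ← lin _ _ _ _ hpc]
    refine aux_inner_int _ _ hfi _ (by fun_prop) hle fun s hs => ?_
    have h1 := aux_b1 hγ hμ (norm_nonneg X) (norm_nonneg Y) (norm_nonneg (x s)) hXδ hYδ (hxδ s hs)
    have h2 : ‖fderiv ℝ (gradient V) X (f (X, Y))‖ ≤
        (k₃ * ‖X‖ ^ (γ - 2)) * (m * (‖X‖ ^ μ + ‖Y‖ ^ μ)) :=
      (ContinuousLinearMap.le_opNorm _ _).trans (by gcongr; exact hhess X)
    calc _ ≤ ((k₃ * ‖X‖ ^ (γ - 2)) * (m * (‖X‖ ^ μ + ‖Y‖ ^ μ))) *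
          (m * (‖X‖ ^ μ + ‖x s‖ ^ μ)) := by
          gcongr
          exact hfb _ _
      _ = k₃ * m ^ 2 * (‖X‖ ^ (γ - 2) * (‖X‖ ^ μ + ‖Y‖ ^ μ) * (‖X‖ ^ μ + ‖x s‖ ^ μ)) := by ring
      _ ≤ k₃ * m ^ 2 * _ := mul_le_mul_of_nonneg_left h1 (by positivity)
      _ = _ := by ring
  have hKc : Continuous fun s => fderiv ℝ (fun x' => f (x', x s)) X (f (X, Y)) := by
    have e : ∀ s, fderiv ℝ (fun x' => f (x', x s)) X (f (X, Y))
        = fderiv ℝ f (X, x s) (f (X, Y), 0) := by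
      intro s
      have h1 : HasFDerivAt f (fderiv ℝ f (X, x s)) (X, x s) :=
        (hf.differentiable one_ne_zero _).hasFDerivAt
      have h2 : HasFDerivAt (fun x' => f (x', x s))
          ((fderiv ℝ f (X, x s)).comp (ContinuousLinearMap.inl ℝ _ _)) X :=
        h1.comp X (hasFDerivAt_prodMk_left X (x s))
      rw [h2.fderiv]
      rfl
    simp_rw [e]
    have hdc : Continuous (fderiv ℝ f) := hf.continuous_fderiv one_ne_zero
    exact (hdc.comp (by fun_prop : Continuous fun s => (X, x s))).clm_apply continuous_const
  have e2 : |⟪gradient V X, K⟫| ≤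
      k₂ * m * m₁ * δ ^ (μ - 1) *
        (h * (4 * ‖X‖ ^ (γ + μ - 1) + 2 * ‖Y‖ ^ (γ + μ - 1)) + 2 * P) := by
    rw [hP, ← lin _ _ _ _ hpc]
    refine aux_inner_int _ _ hKc _ (by fun_prop) hle fun s hs => ?_
    have h1 := aux_b2 hγ hμ (norm_nonneg X) (norm_nonneg Y) (norm_nonneg (x s)) hXδ hYδ (hxδ s hs)
    have h2 : ‖fderiv ℝ (fun x' => f (x', x s)) X (f (X, Y))‖ ≤
        (m₁ * (‖X‖ ^ (μ - 1) + ‖x s‖ ^ (μ - 1))) * (m * (‖X‖ ^ μ + ‖Y‖ ^ μ)) :=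
      (ContinuousLinearMap.le_opNorm _ _).trans (by gcongr; exact hfx X (x s))
    calc _ ≤ (k₂ * ‖X‖ ^ (γ - 1)) *
          ((m₁ * (‖X‖ ^ (μ - 1) + ‖x s‖ ^ (μ - 1))) * (m * (‖X‖ ^ μ + ‖Y‖ ^ μ))) := by
          gcongr
          exact hgrad X
      _ = k₂ * m * m₁ * (‖X‖ ^ (γ - 1) * (‖X‖ ^ μ + ‖Y‖ ^ μ) *
          (‖X‖ ^ (μ - 1) + ‖x s‖ ^ (μ - 1))) := by ring
      _ ≤ k₂ * m * m₁ * _ := mul_le_mul_of_nonneg_left h1 (by positivity)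
      _ = _ := by ring
  have hpt : ∀ s, ‖gradient V X‖ * ‖f (X, x s)‖ ≤
      k₂ * m * (‖X‖ ^ (γ - 1) * (‖X‖ ^ μ + ‖x s‖ ^ μ)) := by
    intro s
    calc _ ≤ (k₂ * ‖X‖ ^ (γ - 1)) * (m * (‖X‖ ^ μ + ‖x s‖ ^ μ)) := by
          gcongr
          · exact hgrad X
          · exact hfb _ _
      _ = _ := by ring
  have e3 : |⟪gradient V X, I⟫| ≤ k₂ * m * δ ^ (μ - 1) * (h * (2 * ‖X‖ ^ γ) + 1 * Q) := by
    rw [hQ, ← lin _ _ _ _ hγc]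
    refine aux_inner_int _ _ hfi _ (by fun_prop) hle fun s hs => (hpt s).trans ?_
    have h1 := aux_b3 hγ hμ (norm_nonneg X) (norm_nonneg (x s)) hXδ (hxδ s hs)
    calc _ ≤ k₂ * m * (δ ^ (μ - 1) * (2 * ‖X‖ ^ γ + ‖x s‖ ^ γ)) := by gcongr
      _ = _ := by ring
  have e4 : |⟪gradient V X, I⟫| ≤ k₂ * m * (h * ((1 + χ ^ (-(2 * μ))) * δ ^ (μ - 1) * ‖X‖ ^ γ) +
      χ ^ (2 * (γ - 1)) * P) := by
    rw [hP, ← lin _ _ _ _ hpc]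
    refine aux_inner_int _ _ hfi _ (by fun_prop) hle fun s hs => (hpt s).trans ?_
    have h1 := aux_young hγ hμ hχ (norm_nonneg X) (norm_nonneg (x s)) hXδ
    gcongr
  have hJc : Continuous fun s => (w₁ + (h + s - t) * w₂) * ‖x s‖ ^ (γ + μ - 1) := by fun_prop
  have e5 : w₁ * P ≤ J := by
    rw [hP, hJ, ← intervalIntegral.integral_const_mul]
    refine intervalIntegral.integral_mono_on hle (hPi.const_mul _)
      (hJc.intervalIntegrable _ _) fun s hs => ?_
    have : 0 ≤ (h + s - t) * w₂ := mul_nonneg (by linarith [hs.1]) hw₂.le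
    gcongr
    linarith
  have e6 : J ≤ (w₁ + h * w₂) * δ ^ (μ - 1) * Q := by
    rw [hQ, hJ, ← intervalIntegral.integral_const_mul]
    refine intervalIntegral.integral_mono_on hle (hJc.intervalIntegrable _ _)
      (hQi.const_mul _) fun s hs => ?_
    have h1 := aux_pd hγ hμ (norm_nonneg (x s)) (hxδ s hs)
    rw [mul_assoc]
    have : h + s - t ≤ h := by linarith [hs.2]
    gcongr
  -- bounds on `v`
  set v := V X + ⟪gradient V X, I⟫ + J with hv
  have hv0 : 0 ≤ v := by
    have h1 := hVlb X
    have h2 := (abs_le.1 e4).1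
    have h3 : 0 ≤ (k₀ - δ ^ (μ - 1) * (h * k₂ * m * (1 + χ ^ (-(2 * μ))))) * ‖X‖ ^ γ :=
      mul_nonneg (by linarith) hXγ
    have h4 : 0 ≤ (w₁ - k₂ * m * χ ^ (2 * (γ - 1))) * P := mul_nonneg (by linarith) hP0
    rw [hv]
    linarith
  have hb0 : 0 < b := by
    rw [hb]; exact lt_max_of_lt_left (by positivity)
  have hvb : v ≤ b * (‖X‖ ^ γ + Q) := by
    have h1 := hVub X
    have h2 := (abs_le.1 e3).2
    have h3 : (k₁ + 2 * h * m * k₂ * δ ^ (μ - 1)) * ‖X‖ ^ γ ≤ b * ‖X‖ ^ γ := by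
      gcongr; rw [hb]; exact le_max_left _ _
    have h4 : ((m * k₂ + w₁ + h * w₂) * δ ^ (μ - 1)) * Q ≤ b * Q := by
      gcongr; rw [hb]; exact le_max_right _ _
    rw [hv]
    linarith
  -- power inequality
  have hγ0 : 0 < γ := by linarith
  set q := (γ + μ - 1) / γ with hq
  have hq1 : q - 1 = (μ - 1) / γ := by rw [hq]; field_simp; ring
  have hqge : 1 ≤ q := by
    have : 0 < (μ - 1) / γ := by positivity
    linarith
  have hgq : γ * q = γ + μ - 1 := by rw [hq]; field_simp
  have hQP : Q ^ q ≤ h ^ (q - 1) * P := by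
    have := aux_jensen (fun s => ‖x s‖ ^ γ) hγc (fun s => rpow_nonneg (norm_nonneg _) _)
      (a := t) hh hqge
    simp only [← rpow_mul (norm_nonneg _), hgq] at this
    exact this
  have hpow : (‖X‖ ^ γ + Q) ^ q ≤ L₁ * (‖X‖ ^ (γ + μ - 1) + P) := by
    have := aux_power hXγ hQ0 hP0 hh hqge hQP
    rwa [← rpow_mul (norm_nonneg _), hgq, hq1, ← hL₁] at this
  have hL₁0 : 0 < L₁ := by rw [hL₁]; positivity
  have hbq : 0 < b ^ q := rpow_pos_of_pos hb0 _
  have hvq : v ^ q ≤ b ^ q * L₁ * (‖X‖ ^ (γ + μ - 1) + P) := by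
    calc v ^ q ≤ (b * (‖X‖ ^ γ + Q)) ^ q := rpow_le_rpow hv0 hvb (by linarith)
      _ = b ^ q * (‖X‖ ^ γ + Q) ^ q := mul_rpow hb0.le (by positivity)
      _ ≤ b ^ q * (L₁ * (‖X‖ ^ (γ + μ - 1) + P)) := by gcongr
      _ = _ := by ring
  have hfin : L₂ * v ^ q ≤ c * (‖X‖ ^ (γ + μ - 1) + P) := by
    have : L₂ * (b ^ q * L₁) = c := by rw [hL₂]; field_simp
    have hL₂0 : 0 ≤ L₂ := by rw [hL₂]; positivity
    calc L₂ * v ^ q ≤ L₂ * (b ^ q * L₁ * (‖X‖ ^ (γ + μ - 1) + P)) := by gcongr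
      _ = _ := by rw [← mul_assoc, this]
  -- conclusion
  have hdVX := hdV X
  have e1' := (abs_le.1 e1).2
  have e2' := (abs_le.1 e2).2
  have c1 : c * ‖X‖ ^ (γ + μ - 1) ≤ (w₀ - 4 * h * L * δ ^ (μ - 1)) * ‖X‖ ^ (γ + μ - 1) := by
    gcongr; rw [hc]; exact min_le_left _ _
  have c2 : c * P ≤ (w₂ - 2 * L * δ ^ (μ - 1)) * P := by
    gcongr; rw [hc]; exact min_le_right _ _
  have c3 : 0 ≤ (w₁ - δ ^ (μ - 1) * (2 * h * L)) * ‖Y‖ ^ (γ + μ - 1) :=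
    mul_nonneg (by linarith) hYp
  rw [inner_sub_right, inner_add_right]
  rw [hL] at c1 c2 c3
  rw [hw₀] at c1
  linarith

/-- Lemma 5: the functional satisfies `v̇(x_t) ≤ -L₂ v(x_t)^{(γ+μ-1)/γ}` along solutions
staying in the ball of radius `δ`. -/
theorem functional_differential_inequality
    {n : ℕ} (hn : 1 ≤ n)
    (h μ : ℝ) (hh : 0 < h) (hμ : 1 < μ)
    (f : EuclideanSpace ℝ (Fin n) × EuclideanSpace ℝ (Fin n) → EuclideanSpace ℝ (Fin n))
    (hf : ContDiff ℝ 1 f)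
    (hhom : ∀ c > (0:ℝ), ∀ x y : EuclideanSpace ℝ (Fin n),
      f (c • x, c • y) = (c ^ μ) • f (x, y))
    (m m₁ : ℝ) (hm : 0 < m) (hm₁ : 0 < m₁)
    (hfb : ∀ x y : EuclideanSpace ℝ (Fin n), ‖f (x, y)‖ ≤ m * (‖x‖ ^ μ + ‖y‖ ^ μ))
    (hfx : ∀ x y : EuclideanSpace ℝ (Fin n),
      ‖fderiv ℝ (fun x' => f (x', y)) x‖ ≤ m₁ * (‖x‖ ^ (μ - 1) + ‖y‖ ^ (μ - 1)))
    (γ : ℝ) (hγ : 2 ≤ γ)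
    (V : EuclideanSpace ℝ (Fin n) → ℝ) (hV : ContDiff ℝ 2 V)
    (k₀ k₁ k₂ k₃ w : ℝ) (hk₀ : 0 < k₀) (hk₁ : 0 < k₁) (hk₂ : 0 < k₂) (hk₃ : 0 < k₃)
    (hw : 0 < w)
    (hVlb : ∀ x : EuclideanSpace ℝ (Fin n), k₀ * ‖x‖ ^ γ ≤ V x)
    (hVub : ∀ x : EuclideanSpace ℝ (Fin n), V x ≤ k₁ * ‖x‖ ^ γ)
    (hgrad : ∀ x : EuclideanSpace ℝ (Fin n), ‖gradient V x‖ ≤ k₂ * ‖x‖ ^ (γ - 1))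
    (hhess : ∀ x : EuclideanSpace ℝ (Fin n),
      ‖fderiv ℝ (gradient V) x‖ ≤ k₃ * ‖x‖ ^ (γ - 2))
    (hdV : ∀ x : EuclideanSpace ℝ (Fin n),
      ⟪gradient V x, f (x, x)⟫ ≤ -w * ‖x‖ ^ (γ + μ - 1))
    (w₀ w₁ w₂ : ℝ) (hw₁ : 0 < w₁) (hw₂ : 0 < w₂)
    (hw₀ : w₀ = w - w₁ - h * w₂) (hw₀pos : 0 < w₀)
    (χ a₂ L H₁ H₂ δ b c L₁ L₂ : ℝ)
    (hχ : 0 < χ)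
    (ha₂ : a₂ = w₁ - k₂ * m * χ ^ (2 * (γ - 1))) (ha₂pos : 0 < a₂)
    (hL : L = m * m₁ * k₂ + m ^ 2 * k₃)
    (hH₁ : H₁ = (k₀ / (h * k₂ * m * (1 + χ ^ (-(2 * μ))))) ^ (1 / (μ - 1)))
    (hH₂ : H₂ = (min (w₀ / (4 * h * L)) (min (w₁ / (2 * h * L)) (w₂ / (2 * L)))) ^
      (1 / (μ - 1)))
    (hδ : δ ∈ Set.Ioo 0 (min H₁ H₂))
    (hb : b = max (k₁ + 2 * h * m * k₂ * δ ^ (μ - 1)) ((m * k₂ + w₁ + h * w₂) * δ ^ (μ - 1)))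
    (hc : c = min (w₀ - 4 * h * L * δ ^ (μ - 1)) (w₂ - 2 * L * δ ^ (μ - 1)))
    (hL₁ : L₁ = (2 * max 1 h) ^ ((μ - 1) / γ))
    (hL₂ : L₂ = c / (b ^ ((γ + μ - 1) / γ) * L₁))
    (x : ℝ → EuclideanSpace ℝ (Fin n))
    (hxc : ContinuousOn x (Set.Ici (-h)))
    (hxd : ∀ t > (0:ℝ), HasDerivAt x (f (x t, x (t - h))) t)
    (t : ℝ) (ht : 0 < t)
    (hxδ : ∀ θ ∈ Set.Icc (-h) (0:ℝ), ‖x (t + θ)‖ ≤ δ) :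
    DifferentiableAt ℝ (fun τ => V (x τ) +
        ⟪gradient V (x τ), ∫ s in (τ - h)..τ, f (x τ, x s)⟫ +
        ∫ s in (τ - h)..τ, (w₁ + (h + s - τ) * w₂) * ‖x s‖ ^ (γ + μ - 1)) t ∧
      deriv (fun τ => V (x τ) +
        ⟪gradient V (x τ), ∫ s in (τ - h)..τ, f (x τ, x s)⟫ +
        ∫ s in (τ - h)..τ, (w₁ + (h + s - τ) * w₂) * ‖x s‖ ^ (γ + μ - 1)) t ≤
      -L₂ * (V (x t) + ⟪gradient V (x t), ∫ s in (t - h)..t, f (x t, x s)⟫ +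
        ∫ s in (t - h)..t, (w₁ + (h + s - t) * w₂) * ‖x s‖ ^ (γ + μ - 1)) ^
          ((γ + μ - 1) / γ) := by
  have hyc : Continuous fun s => x (max s (-h)) :=
    hxc.comp_continuous (by fun_prop) fun s => Set.mem_Ici.2 (le_max_right _ _)
  have hy : ∀ s, -h ≤ s → x (max s (-h)) = x s := fun s hs => by rw [max_eq_left hs]
  have hnear : ∀ᶠ τ in nhds t, 0 < τ := lt_mem_nhds ht
  have hyt : (fun s => x (max s (-h))) =ᶠ[nhds t] x :=
    hnear.mono fun τ hτ => hy τ (by linarith)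
  have hyd : HasDerivAt (fun s => x (max s (-h)))
      (f (x (max t (-h)), x (max (t - h) (-h)))) t := by
    rw [hy t (by linarith), hy (t - h) (by linarith)]
    exact (hxd t ht).congr_of_eventuallyEq hyt
  have hyδ : ∀ s ∈ Set.Icc (t - h) t, ‖x (max s (-h))‖ ≤ δ := by
    intro s hs
    rw [hy s (by linarith [hs.1])]
    have := hxδ (s - t) ⟨by linarith [hs.1], by linarith [hs.2]⟩
    simpa using this
  have key := aux_core h μ hh hμ f hf m m₁ hm hm₁ hfb hfx γ hγ V hV k₀ k₁ k₂ k₃ w hk₀ hk₁ hk₂ hk₃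
    hw hVlb hVub hgrad hhess hdV w₀ w₁ w₂ hw₁ hw₂ hw₀ hw₀pos χ a₂ L H₁ H₂ δ b c L₁ L₂ hχ ha₂ ha₂pos
    hL hH₁ hH₂ hδ hb hc hL₁ hL₂ (fun s => x (max s (-h))) hyc t hyd hyδ
  have hpt : ∀ τ, 0 < τ →
      V (x (max τ (-h))) +
        ⟪gradient V (x (max τ (-h))), ∫ s in (τ - h)..τ, f (x (max τ (-h)), x (max s (-h)))⟫ +
        ∫ s in (τ - h)..τ, (w₁ + (h + s - τ) * w₂) * ‖x (max s (-h))‖ ^ (γ + μ - 1) =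
      V (x τ) + ⟪gradient V (x τ), ∫ s in (τ - h)..τ, f (x τ, x s)⟫ +
        ∫ s in (τ - h)..τ, (w₁ + (h + s - τ) * w₂) * ‖x s‖ ^ (γ + μ - 1) := by
    intro τ hτ
    have hs : ∀ s ∈ Set.uIcc (τ - h) τ, x (max s (-h)) = x s := by
      intro s hs
      rw [Set.uIcc_of_le (by linarith)] at hs
      exact hy s (by linarith [hs.1])
    rw [hy τ (by linarith)]
    congr 1
    · congr 2
      exact intervalIntegral.integral_congr fun s h1 => by simp only [hs s h1]
    · exact intervalIntegral.integral_congr fun s h1 => by simp only [hs s h1]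
  have hev := hnear.mono hpt
  refine ⟨key.1.congr_of_eventuallyEq (Filter.EventuallyEq.symm hev), ?_⟩
  have h2 := key.2
  rw [hpt t ht] at h2
  rw [← Filter.EventuallyEq.deriv_eq hev]
  exact h2
end
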